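/- arXiv:2306.03589 — 2 statements merged into one kernel-verified Lean document; each statement's English description precedes it below -/
import Mathlib

section
/- Let 0 < c₂ ≤ 1 and let τ(v,u) be the commute time between nodes v and u. Then for all v,u ∈ V, Σ_{ℓ=1}^{n−1} (1/(c₂λ_ℓ)) φ_ℓ(v) φ_ℓ(u) ≤ −(τ(v,u)/(4c₂|E|))·√(d_v d_u) + (1/(2c₂λ₁))·( √(d_v/d_u) + √(d_u/d_v) − √(d_v d_u)/|E| ). -/
open scoped BigOperators

noncomputable section

namespace OSQ

variable {n d : ℕ}

/-- componentwise application of the activation function. -/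
def act (σ : ℝ → ℝ) (x : EuclideanSpace ℝ (Fin d)) : EuclideanSpace ℝ (Fin d) :=
  WithLp.toLp 2 fun i => σ (x i)

/-- node features computed by the MPNN after `t` layers. -/
def mpnn (σ : ℝ → ℝ) (𝒜 : Matrix (Fin n) (Fin n) ℝ)
    (Ω W : ℕ → EuclideanSpace ℝ (Fin d) →L[ℝ] EuclideanSpace ℝ (Fin d))
    (ψ : ℕ → EuclideanSpace ℝ (Fin d) × EuclideanSpace ℝ (Fin d) → EuclideanSpace ℝ (Fin d)) :
    ℕ → (Fin n → EuclideanSpace ℝ (Fin d)) → Fin n → EuclideanSpace ℝ (Fin d)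
  | 0, X, v => X v
  | (t+1), X, v =>
    act σ (Ω (t+1) (mpnn σ 𝒜 Ω W ψ t X v)
      + W (t+1) (∑ u : Fin n, 𝒜 v u • ψ (t+1) (mpnn σ 𝒜 Ω W ψ t X v, mpnn σ 𝒜 Ω W ψ t X u)))

/-- coordinate direction in the input space: a perturbation of entry `β` of the
feature of node `u`. -/
def dir (u : Fin n) (β : Fin d) : Fin n → EuclideanSpace ℝ (Fin d) :=
  Pi.single u (EuclideanSpace.single β 1)

/-- `∂ h_v^{(m),α} / ∂ x_u^β`. -/
def jacEntry (σ : ℝ → ℝ) (𝒜 : Matrix (Fin n) (Fin n) ℝ)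
    (Ω W : ℕ → EuclideanSpace ℝ (Fin d) →L[ℝ] EuclideanSpace ℝ (Fin d))
    (ψ : ℕ → EuclideanSpace ℝ (Fin d) × EuclideanSpace ℝ (Fin d) → EuclideanSpace ℝ (Fin d))
    (m : ℕ) (v u : Fin n) (X : Fin n → EuclideanSpace ℝ (Fin d)) (α β : Fin d) : ℝ :=
  fderiv ℝ (fun Y => mpnn σ 𝒜 Ω W ψ m Y v α) X (dir u β)

/-- `∂² h_i^{(m),α} / ∂ x_v^β ∂ x_u^γ`. -/
def hessEntry (σ : ℝ → ℝ) (𝒜 : Matrix (Fin n) (Fin n) ℝ)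
    (Ω W : ℕ → EuclideanSpace ℝ (Fin d) →L[ℝ] EuclideanSpace ℝ (Fin d))
    (ψ : ℕ → EuclideanSpace ℝ (Fin d) × EuclideanSpace ℝ (Fin d) → EuclideanSpace ℝ (Fin d))
    (m : ℕ) (i v u : Fin n) (X : Fin n → EuclideanSpace ℝ (Fin d)) (α β γ : Fin d) : ℝ :=
  fderiv ℝ (fun Y => fderiv ℝ (fun Z => mpnn σ 𝒜 Ω W ψ m Z i α) Y (dir u γ)) X (dir v β)

/-- graph-level prediction with SUM readout: `y(X) = θᵀ Σ_v h_v^{(m)}`. -/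
def readout (θ : EuclideanSpace ℝ (Fin d)) (σ : ℝ → ℝ) (𝒜 : Matrix (Fin n) (Fin n) ℝ)
    (Ω W : ℕ → EuclideanSpace ℝ (Fin d) →L[ℝ] EuclideanSpace ℝ (Fin d))
    (ψ : ℕ → EuclideanSpace ℝ (Fin d) × EuclideanSpace ℝ (Fin d) → EuclideanSpace ℝ (Fin d))
    (m : ℕ) (X : Fin n → EuclideanSpace ℝ (Fin d)) : ℝ :=
  ∑ α : Fin d, θ α * (∑ v : Fin n, mpnn σ 𝒜 Ω W ψ m X v) α

/-- `∂² y^{(m)} / ∂ x_v^α ∂ x_u^β`. -/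
def mixEntry (θ : EuclideanSpace ℝ (Fin d)) (σ : ℝ → ℝ) (𝒜 : Matrix (Fin n) (Fin n) ℝ)
    (Ω W : ℕ → EuclideanSpace ℝ (Fin d) →L[ℝ] EuclideanSpace ℝ (Fin d))
    (ψ : ℕ → EuclideanSpace ℝ (Fin d) × EuclideanSpace ℝ (Fin d) → EuclideanSpace ℝ (Fin d))
    (m : ℕ) (v u : Fin n) (X : Fin n → EuclideanSpace ℝ (Fin d)) (α β : Fin d) : ℝ :=
  fderiv ℝ (fun Y => fderiv ℝ (fun Z => readout θ σ 𝒜 Ω W ψ m Z) Y (dir u β)) X (dir v α)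

/-- the matrix `S := (ω/w)I + c₁ diag(𝒜 1) + c₂ 𝒜`. -/
def Smat (ω w c₁ c₂ : ℝ) (𝒜 : Matrix (Fin n) (Fin n) ℝ) : Matrix (Fin n) (Fin n) ℝ :=
  (ω / w) • (1 : Matrix (Fin n) (Fin n) ℝ)
    + c₁ • Matrix.diagonal (fun i => ∑ j, 𝒜 i j) + c₂ • 𝒜

/-- `diag(𝒜 1)` : the diagonal matrix of row sums. -/
def rowSumDiag (𝒜 : Matrix (Fin n) (Fin n) ℝ) : Matrix (Fin n) (Fin n) ℝ :=
  Matrix.diagonal (fun i => ∑ j, 𝒜 i j)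

/-- `diag(1ᵀ M)` : the diagonal matrix of column sums. -/
def colSumDiag (M : Matrix (Fin n) (Fin n) ℝ) : Matrix (Fin n) (Fin n) ℝ :=
  Matrix.diagonal (fun j => ∑ i, M i j)

/-- the operator (spectral) norm of a matrix, viewed as a linear map between
Euclidean spaces. -/
def matOpNorm {ι κ : Type*} [Fintype ι] [Fintype κ] [DecidableEq ι] (M : Matrix κ ι ℝ) : ℝ :=
  ‖LinearMap.toContinuousLinearMap (Matrix.toEuclideanLin M)‖


/-- the symmetrically-normalized adjacency matrix `A_sym := D^{-1/2} A D^{-1/2}`. -/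
def Asym (G : SimpleGraph (Fin n)) [DecidableRel G.Adj] : Matrix (Fin n) (Fin n) ℝ :=
  Matrix.diagonal (fun a => (Real.sqrt (G.degree a))⁻¹) * G.adjMatrix ℝ *
    Matrix.diagonal (fun a => (Real.sqrt (G.degree a))⁻¹)

/-- the random-walk normalized adjacency matrix `D^{-1} A`. -/
def Arw (G : SimpleGraph (Fin n)) [DecidableRel G.Adj] : Matrix (Fin n) (Fin n) ℝ :=
  Matrix.diagonal (fun a => ((G.degree a : ℝ))⁻¹) * G.adjMatrix ℝ
/-- the normalized graph Laplacian `Δ := I - A_sym`. -/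
def nLap (G : SimpleGraph (Fin n)) [DecidableRel G.Adj] : Matrix (Fin n) (Fin n) ℝ :=
  1 - Asym G

/-- the matrix `Z := I - c₂ Δ`. -/
def Zmat (c₂ : ℝ) (G : SimpleGraph (Fin n)) [DecidableRel G.Adj] : Matrix (Fin n) (Fin n) ℝ :=
  1 - c₂ • nLap G

/-- the commute time `τ(v,u) = 2|E| Σ_{ℓ≥1} (1/λ_ℓ)(φ_ℓ(v)/√d_v - φ_ℓ(u)/√d_u)²`,
expressed spectrally. -/
def commuteTime (G : SimpleGraph (Fin n)) [DecidableRel G.Adj]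
    (lam : Fin n → ℝ) (φ : Fin n → Fin n → ℝ) (v u : Fin n) : ℝ :=
  2 * (G.edgeFinset.card : ℝ) *
    ∑ ℓ ∈ Finset.univ.filter (fun ℓ : Fin n => (ℓ : ℕ) ≠ 0),
      (1 / lam ℓ) *
        (φ ℓ v / Real.sqrt (G.degree v) - φ ℓ u / Real.sqrt (G.degree u)) ^ 2

/-- the pseudo-inverse `Δ† := Σ_{ℓ≥1} (1/λ_ℓ) φ_ℓ φ_ℓᵀ` of the normalized Laplacian. -/
def nLapPinv (lam : Fin n → ℝ) (φ : Fin n → Fin n → ℝ) : Matrix (Fin n) (Fin n) ℝ :=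
  Matrix.of fun a b =>
    ∑ ℓ ∈ Finset.univ.filter (fun ℓ : Fin n => (ℓ : ℕ) ≠ 0), (1 / lam ℓ) * (φ ℓ a * φ ℓ b)
/-- commute-time bound on the spectral sum `Σ_{ℓ≥1}(1/(c₂λ_ℓ))φ_ℓ(v)φ_ℓ(u)`. -/
theorem spectral_sum_commute_time_bound (hn : 1 < n)
    (G : SimpleGraph (Fin n)) [DecidableRel G.Adj] (hconn : G.Connected)
    (c₂ : ℝ) (hc₂0 : 0 < c₂) (hc₂1 : c₂ ≤ 1)
    (lam : Fin n → ℝ) (φ : Fin n → Fin n → ℝ)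
    (horth : ∀ k l, ∑ a, φ k a * φ l a = if k = l then (1 : ℝ) else 0)
    (heig : ∀ ℓ, (nLap G).mulVec (φ ℓ) = lam ℓ • φ ℓ)
    (hmono : Monotone lam)
    (hlam0 : lam ⟨0, by omega⟩ = 0)
    (hlampos : ∀ ℓ : Fin n, (ℓ : ℕ) ≠ 0 → 0 < lam ℓ)
    (hlamlt : ∀ ℓ, lam ℓ < 2)
    (hφ0 : ∀ a, φ ⟨0, by omega⟩ a = Real.sqrt ((G.degree a : ℝ) / (2 * G.edgeFinset.card)))
    (v u : Fin n) :
    ∑ ℓ ∈ Finset.univ.filter (fun ℓ : Fin n => (ℓ : ℕ) ≠ 0),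
        (1 / (c₂ * lam ℓ)) * (φ ℓ v * φ ℓ u)
      ≤ -(commuteTime G lam φ v u / (4 * c₂ * (G.edgeFinset.card : ℝ))) *
            Real.sqrt ((G.degree v : ℝ) * (G.degree u : ℝ))
        + (1 / (2 * c₂ * lam ⟨1, hn⟩)) *
            (Real.sqrt ((G.degree v : ℝ) / (G.degree u : ℝ))
              + Real.sqrt ((G.degree u : ℝ) / (G.degree v : ℝ))
              - Real.sqrt ((G.degree v : ℝ) * (G.degree u : ℝ)) / (G.edgeFinset.card : ℝ)) := by
  have hnt : Nontrivial (Fin n) := Fin.nontrivial_iff_two_le.mpr hn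
  have hdeg : ∀ a, 0 < G.degree a := fun a => hconn.preconnected.degree_pos_of_nontrivial a
  have hE : 0 < (G.edgeFinset.card : ℝ) := by
    have h1 := G.sum_degrees_eq_twice_card_edges
    have h2 : G.degree v ≤ ∑ a, G.degree a :=
      Finset.single_le_sum (f := fun a => G.degree a) (fun _ _ => Nat.zero_le _) (Finset.mem_univ v)
    have h3 := hdeg v
    have : 0 < G.edgeFinset.card := by omega
    exact_mod_cast this
  -- completeness of the eigenbasis
  have hcomp : ∀ a, ∑ l, φ l a ^ 2 = 1 := by
    intro a
    have h1 : (Matrix.of φ) * (Matrix.of φ).transpose = 1 := by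
      ext k l
      simp [Matrix.mul_apply, horth, Matrix.one_apply]
    have h2 : (Matrix.of φ).transpose * (Matrix.of φ) = 1 := mul_eq_one_comm.mp h1
    have h3 := congrFun (congrFun h2 a) a
    simpa [Matrix.mul_apply, pow_two] using h3
  set E : ℝ := (G.edgeFinset.card : ℝ) with hEdef
  set F := Finset.univ.filter (fun l : Fin n => (l : ℕ) ≠ 0) with hF
  have hsum : ∀ a, ∑ l ∈ F, φ l a ^ 2 = 1 - (G.degree a : ℝ) / (2 * E) := by
    intro a
    have h1 := hcomp a
    have h0 : F = Finset.univ.erase ⟨0, by omega⟩ := by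
      ext l
      simp [hF, Fin.ext_iff]
    rw [← Finset.add_sum_erase _ _ (Finset.mem_univ (⟨0, by omega⟩ : Fin n)), hφ0 a,
      Real.sq_sqrt (by positivity)] at h1
    rw [h0]
    linarith
  have hv : 0 < (G.degree v : ℝ) := by exact_mod_cast hdeg v
  have hu : 0 < (G.degree u : ℝ) := by exact_mod_cast hdeg u
  rw [Real.sqrt_mul hv.le, Real.sqrt_div hv.le, Real.sqrt_div hu.le]
  unfold commuteTime
  rw [← hF, ← hEdef]
  obtain ⟨s, hs⟩ : ∃ s, s = Real.sqrt (G.degree v : ℝ) := ⟨_, rfl⟩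
  obtain ⟨t, ht⟩ : ∃ t, t = Real.sqrt (G.degree u : ℝ) := ⟨_, rfl⟩
  have hs0 : 0 < s := hs ▸ Real.sqrt_pos.mpr hv
  have ht0 : 0 < t := ht ▸ Real.sqrt_pos.mpr hu
  have hss : (G.degree v : ℝ) = s ^ 2 := by rw [hs, Real.sq_sqrt hv.le]
  have htt : (G.degree u : ℝ) = t ^ 2 := by rw [ht, Real.sq_sqrt hu.le]
  have hsv := hsum v
  have hsu := hsum u
  rw [hss] at hsv
  rw [htt] at hsu
  rw [← hs, ← ht]
  have hl1 : 0 < lam ⟨1, hn⟩ := hlampos _ (by simp)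
  set L := lam ⟨1, hn⟩ with hL
  have key : ∀ l ∈ F, (1 / (c₂ * lam l)) * (φ l v * φ l u) ≤
      -(s * t / (2 * c₂)) * ((1 / lam l) * (φ l v / s - φ l u / t) ^ 2)
        + (1 / (2 * c₂ * L)) * (t / s * φ l v ^ 2 + s / t * φ l u ^ 2) := by
    intro l hl
    have hl0 : (l : ℕ) ≠ 0 := by simpa [hF] using hl
    have hp := hlampos l hl0
    have hle : L ≤ lam l := hmono (by rw [Fin.le_def]; simp; omega)
    have e : (1 / (c₂ * lam l)) * (φ l v * φ l u) =
      -(s * t / (2 * c₂)) * ((1 / lam l) * (φ l v / s - φ l u / t) ^ 2)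
        + (1 / (2 * c₂ * lam l)) * (t / s * φ l v ^ 2 + s / t * φ l u ^ 2) := by
      field_simp
      ring
    rw [e]
    gcongr
  refine (Finset.sum_le_sum key).trans (le_of_eq ?_)
  rw [Finset.sum_add_distrib, ← Finset.mul_sum, ← Finset.mul_sum, Finset.sum_add_distrib,
    ← Finset.mul_sum, ← Finset.mul_sum, hsv, hsu]
  generalize ∑ l ∈ F, (1 / lam l) * (φ l v / s - φ l u / t) ^ 2 = T
  field_simp
  ring
end OSQ
end
end

section
/- Let 𝖠 = A_sym, suppose |σ'|≤1, |σ''|≤1, 0 < c₂ ≤ 1, and max{w, ω/w + c₁γ + c₂} ≤ 1. Let v≠u, r := d_G(v,u), μ := 1 + 2c^{(2)}(1+γ), and |1−c₂λ*| := max_{1≤ℓ≤n−1}|1−c₂λ_ℓ| < 1. If the MPNN generates mixing M > 0 among v and u, i.e. there exist an input X and coordinates 1≤α,β≤d with |∂²y^{(m)}(X)/∂x_v^α∂x_u^β| ≥ M, then the depth m satisfies m ≥ τ(v,u)/(4c₂) + (|E|/√(d_v d_u))·( M/(γμ) − (1/c₂)·( (γ + |1−c₂λ*|^{r−1})/λ₁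 + 2c^{(2)}/μ ) ). -/
open scoped BigOperators

noncomputable section

namespace OSQ

variable {n d : ℕ}

section Analytic

variable {V E₁ E₂ : Type*} [NormedAddCommGroup V] [NormedSpace ℝ V]
  [NormedAddCommGroup E₁] [NormedSpace ℝ E₁] [NormedAddCommGroup E₂] [NormedSpace ℝ E₂]

/-- second directional derivative. -/
def D2 (F : V → E₁) (Y e e' : V) : E₁ := fderiv ℝ (fun Z => fderiv ℝ F Z e') Y e

lemma c2_diff {F : V → E₁} (hF : ContDiff ℝ 2 F) : Differentiable ℝ F :=
  hF.differentiable (by norm_num)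

lemma c2_fderiv_diff {F : V → E₁} (hF : ContDiff ℝ 2 F) : Differentiable ℝ (fderiv ℝ F) :=
  (hF.fderiv_right (m := 1) (by norm_num)).differentiable (by norm_num)

lemma c2_dir_diff {F : V → E₁} (hF : ContDiff ℝ 2 F) (e : V) :
    Differentiable ℝ (fun Z => fderiv ℝ F Z e) := by
  have := c2_fderiv_diff hF
  fun_prop

lemma D2_eq {F : V → E₁} (hF : ContDiff ℝ 2 F) (Y e e' : V) :
    D2 F Y e e' = fderiv ℝ (fderiv ℝ F) Y e e' := by
  unfold D2
  rw [fderiv_clm_apply (c2_fderiv_diff hF Y) (by fun_prop)]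
  simp

lemma D2_comp {f : E₁ → E₂} {p : V → E₁} (hf : ContDiff ℝ 2 f) (hp : ContDiff ℝ 2 p)
    (Y e e' : V) :
    D2 (fun Z => f (p Z)) Y e e' =
      D2 f (p Y) (fderiv ℝ p Y e) (fderiv ℝ p Y e') + fderiv ℝ f (p Y) (D2 p Y e e') := by
  have h1 : (fun Z => fderiv ℝ (fun Z => f (p Z)) Z e')
      = fun Z => fderiv ℝ f (p Z) (fderiv ℝ p Z e') := by
    funext Z
    rw [show (fun Z => f (p Z)) = f ∘ p from rfl,
      fderiv_comp Z (c2_diff hf _) (c2_diff hp _)]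
    rfl
  have hd : DifferentiableAt ℝ (fun Z => fderiv ℝ f (p Z)) Y :=
    (c2_fderiv_diff hf _).comp Y (c2_diff hp _)
  rw [D2_eq hf]
  unfold D2
  rw [h1, fderiv_clm_apply hd (c2_dir_diff hp e' Y)]
  have h2 : fderiv ℝ (fun Z => fderiv ℝ f (p Z)) Y
      = (fderiv ℝ (fderiv ℝ f) (p Y)).comp (fderiv ℝ p Y) := by
    rw [show (fun Z => fderiv ℝ f (p Z)) = (fderiv ℝ f) ∘ p from rfl,
      fderiv_comp Y (c2_fderiv_diff hf _) (c2_diff hp _)]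
  simp [h2, add_comm]

lemma D2_clm (L : E₁ →L[ℝ] E₂) {p : V → E₁} (hp : ContDiff ℝ 2 p) (Y e e' : V) :
    D2 (fun Z => L (p Z)) Y e e' = L (D2 p Y e e') := by
  rw [D2_comp L.contDiff hp]
  simp [D2]

lemma D1_clm (L : E₁ →L[ℝ] E₂) {p : V → E₁} (hp : ContDiff ℝ 2 p) (Y e : V) :
    fderiv ℝ (fun Z => L (p Z)) Y e = L (fderiv ℝ p Y e) := by
  rw [show (fun Z => L (p Z)) = L ∘ p from rfl,
    fderiv_comp Y L.differentiableAt (c2_diff hp _)]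
  simp

lemma D2_add {p q : V → E₁} (hp : ContDiff ℝ 2 p) (hq : ContDiff ℝ 2 q) (Y e e' : V) :
    D2 (fun Z => p Z + q Z) Y e e' = D2 p Y e e' + D2 q Y e e' := by
  unfold D2
  have : (fun Z => fderiv ℝ (fun Z => p Z + q Z) Z e')
      = fun Z => fderiv ℝ p Z e' + fderiv ℝ q Z e' := by
    funext Z
    rw [fderiv_fun_add (c2_diff hp _) (c2_diff hq _)]
    rfl
  rw [this, fderiv_fun_add (c2_dir_diff hp e' Y) (c2_dir_diff hq e' Y)]
  rfl

lemma D1_sum {ι : Type*} (s : Finset ι) {p : ι → V → E₁} (hp : ∀ i, ContDiff ℝ 2 (p i))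
    (Y e : V) :
    fderiv ℝ (fun Z => ∑ i ∈ s, p i Z) Y e = ∑ i ∈ s, fderiv ℝ (p i) Y e := by
  rw [fderiv_fun_sum (fun i _ => c2_diff (hp i) _)]
  simp

lemma D2_sum {ι : Type*} (s : Finset ι) {p : ι → V → E₁} (hp : ∀ i, ContDiff ℝ 2 (p i))
    (Y e e' : V) :
    D2 (fun Z => ∑ i ∈ s, p i Z) Y e e' = ∑ i ∈ s, D2 (p i) Y e e' := by
  unfold D2
  have : (fun Z => fderiv ℝ (fun Z => ∑ i ∈ s, p i Z) Z e')
      = fun Z => ∑ i ∈ s, fderiv ℝ (p i) Z e' := by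
    funext Z
    exact D1_sum s hp Z e'
  rw [this, fderiv_fun_sum (fun i _ => c2_dir_diff (hp i) e' Y)]
  simp

lemma D1_smul (a : ℝ) {p : V → E₁} (hp : ContDiff ℝ 2 p) (Y e : V) :
    fderiv ℝ (fun Z => a • p Z) Y e = a • fderiv ℝ p Y e := by
  rw [fderiv_fun_const_smul (c2_diff hp _)]
  rfl

lemma D2_smul (a : ℝ) {p : V → E₁} (hp : ContDiff ℝ 2 p) (Y e e' : V) :
    D2 (fun Z => a • p Z) Y e e' = a • D2 p Y e e' := by
  unfold D2
  have : (fun Z => fderiv ℝ (fun Z => a • p Z) Z e')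
      = fun Z => a • fderiv ℝ p Z e' := by
    funext Z
    exact D1_smul a hp Z e'
  rw [this, fderiv_fun_const_smul (c2_dir_diff hp e' Y)]
  rfl

lemma D1_pair {p : V → E₁} {q : V → E₂} (hp : ContDiff ℝ 2 p) (hq : ContDiff ℝ 2 q) (Y e : V) :
    fderiv ℝ (fun Z => (p Z, q Z)) Y e = (fderiv ℝ p Y e, fderiv ℝ q Y e) := by
  rw [DifferentiableAt.fderiv_prodMk (c2_diff hp _) (c2_diff hq _)]
  rfl

lemma D2_pair {p : V → E₁} {q : V → E₂} (hp : ContDiff ℝ 2 p) (hq : ContDiff ℝ 2 q)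
    (Y e e' : V) :
    D2 (fun Z => (p Z, q Z)) Y e e' = (D2 p Y e e', D2 q Y e e') := by
  unfold D2
  have : (fun Z => fderiv ℝ (fun Z => (p Z, q Z)) Z e')
      = fun Z => (fderiv ℝ p Z e', fderiv ℝ q Z e') := by
    funext Z
    exact D1_pair hp hq Z e'
  rw [this, DifferentiableAt.fderiv_prodMk (c2_dir_diff hp e' Y) (c2_dir_diff hq e' Y)]
  rfl

lemma D1_psi_bound {f : E₁ × E₁ → E₂} (hf : ContDiff ℝ 2 f) {c₁ c₂ : ℝ}
    (h1 : ∀ x y, ‖fderiv ℝ (fun z => f (z, y)) x‖ ≤ c₁)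
    (h2 : ∀ x y, ‖fderiv ℝ (fun z => f (x, z)) y‖ ≤ c₂) (x y a b : E₁) :
    ‖fderiv ℝ f (x, y) (a, b)‖ ≤ c₁ * ‖a‖ + c₂ * ‖b‖ := by
  have e1 : fderiv ℝ (fun z => f (z, y)) x a = fderiv ℝ f (x, y) (a, 0) := by
    rw [show (fun z => f (z, y)) = f ∘ (fun z => (z, y)) from rfl,
      fderiv_comp x (c2_diff hf _) (by fun_prop),
      DifferentiableAt.fderiv_prodMk (by fun_prop) (by fun_prop)]
    simp
  have e2 : fderiv ℝ (fun z => f (x, z)) y b = fderiv ℝ f (x, y) (0, b) := by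
    rw [show (fun z => f (x, z)) = f ∘ (fun z => (x, z)) from rfl,
      fderiv_comp y (c2_diff hf _) (by fun_prop),
      DifferentiableAt.fderiv_prodMk (by fun_prop) (by fun_prop)]
    simp
  have e3 : fderiv ℝ f (x, y) (a, b)
      = fderiv ℝ (fun z => f (z, y)) x a + fderiv ℝ (fun z => f (x, z)) y b := by
    rw [e1, e2, ← map_add]
    simp
  rw [e3]
  refine (norm_add_le _ _).trans (add_le_add ?_ ?_)
  · exact (ContinuousLinearMap.le_opNorm _ _).trans
      (mul_le_mul_of_nonneg_right (h1 x y) (norm_nonneg _))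
  · exact (ContinuousLinearMap.le_opNorm _ _).trans
      (mul_le_mul_of_nonneg_right (h2 x y) (norm_nonneg _))

lemma D2_iter_bound {f : E₁ → E₂} (hf : ContDiff ℝ 2 f) {c : ℝ}
    (h : ∀ p, ‖iteratedFDeriv ℝ 2 f p‖ ≤ c) (p a b : E₁) :
    ‖D2 f p a b‖ ≤ c * (‖a‖ * ‖b‖) := by
  rw [D2_eq hf]
  have := iteratedFDeriv_two_apply (𝕜 := ℝ) f p ![a, b]
  simp only [Matrix.cons_val_zero, Matrix.cons_val_one] at this
  rw [← this]
  refine (ContinuousMultilinearMap.le_opNorm _ _).trans ?_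
  rw [Fin.prod_univ_two]
  exact mul_le_mul_of_nonneg_right (h p) (by positivity)

lemma norm_pair_le (a b : E₁) : ‖(a, b)‖ ≤ ‖a‖ + ‖b‖ := by
  rw [Prod.norm_mk]
  exact max_le (by linarith [norm_nonneg b]) (by linarith [norm_nonneg a])

/-- coordinate projection -/
abbrev prj (i : Fin d) : EuclideanSpace ℝ (Fin d) →L[ℝ] ℝ := EuclideanSpace.proj (𝕜 := ℝ) i


lemma act_contDiff {σ : ℝ → ℝ} (hσ : ContDiff ℝ 2 σ) :
    ContDiff ℝ 2 (act (d := d) σ) := by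
  rw [contDiff_euclidean]
  intro i
  change ContDiff ℝ 2 (fun x : EuclideanSpace ℝ (Fin d) => σ (x i))
  exact hσ.comp (prj (d := d) i).contDiff

lemma act_D1 {σ : ℝ → ℝ} (hσ : ContDiff ℝ 2 σ) (x h : EuclideanSpace ℝ (Fin d)) (i : Fin d) :
    (fderiv ℝ (act σ) x h) i = deriv σ (x i) * h i := by
  have h1 := D1_clm (prj (d := d) i)
    (act_contDiff (d := d) hσ) x h
  change _ = (fderiv ℝ (act σ) x h) i at h1
  rw [← h1]
  change fderiv ℝ (σ ∘ fun x : EuclideanSpace ℝ (Fin d) => x i) x h = _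
  have h2 := fderiv_comp x (g := σ) (f := prj (d := d) i) (c2_diff hσ _)
    (prj (d := d) i).differentiableAt
  change fderiv ℝ (σ ∘ prj (d := d) i) x h = _
  rw [h2, ContinuousLinearMap.comp_apply, ContinuousLinearMap.fderiv, fderiv_eq_smul_deriv]
  simp [mul_comm]

lemma act_D2 {σ : ℝ → ℝ} (hσ : ContDiff ℝ 2 σ) (x h k : EuclideanSpace ℝ (Fin d)) (i : Fin d) :
    (D2 (act σ) x h k) i = deriv (deriv σ) (x i) * h i * k i := by
  have h1 := D2_clm (prj (d := d) i)
    (act_contDiff (d := d) hσ) x h k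
  change _ = (D2 (act σ) x h k) i at h1
  rw [← h1]
  change D2 (fun y : EuclideanSpace ℝ (Fin d) => σ (prj (d := d) i y)) x h k = _
  rw [D2_comp hσ (prj (d := d) i).contDiff]
  rw [ContinuousLinearMap.fderiv]
  have : D2 (fun y => prj (d := d) i y) x h k = 0 := by
    unfold D2
    have : (fun Z => fderiv ℝ (fun y => prj (d := d) i y) Z k) = fun _ => prj (d := d) i k := by
      funext Z
      exact congrArg (fun L => L k) (prj (d := d) i).fderiv
    rw [this]
    simp
  rw [show (⇑(prj (d := d) i)) = fun y => prj (d := d) i y from rfl, this]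
  simp only [map_zero, add_zero]
  unfold D2
  have h3 : ∀ b : ℝ, (fun z => fderiv ℝ σ z b) = fun z => b * deriv σ z := by
    intro b
    funext z
    rw [fderiv_eq_smul_deriv]; simp
  rw [h3, fderiv_eq_smul_deriv, deriv_const_mul_field]
  simp
  ring

lemma act_D1_bound {σ : ℝ → ℝ} (hσ : ContDiff ℝ 2 σ) (hσ' : ∀ x, |deriv σ x| ≤ 1)
    (x h : EuclideanSpace ℝ (Fin d)) :
    ‖fderiv ℝ (act σ) x h‖ ≤ ‖h‖ := by
  rw [EuclideanSpace.norm_eq, EuclideanSpace.norm_eq]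
  refine Real.sqrt_le_sqrt (Finset.sum_le_sum fun i _ => ?_)
  rw [act_D1 hσ, norm_mul]
  have : ‖deriv σ (x i)‖ * ‖h i‖ ≤ ‖h i‖ :=
    mul_le_of_le_one_left (norm_nonneg _) (hσ' _)
  gcongr

lemma act_D2_bound {σ : ℝ → ℝ} (hσ : ContDiff ℝ 2 σ) (hσ'' : ∀ x, |deriv (deriv σ) x| ≤ 1)
    (x h k : EuclideanSpace ℝ (Fin d)) :
    ‖D2 (act σ) x h k‖ ≤ ‖h‖ * ‖k‖ := by
  rw [EuclideanSpace.norm_eq]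
  refine Real.sqrt_le_iff.2 ⟨by positivity, ?_⟩
  rw [mul_pow, EuclideanSpace.norm_sq_eq h, Finset.sum_mul]
  refine Finset.sum_le_sum fun i _ => ?_
  rw [act_D2 hσ, norm_mul, norm_mul, mul_assoc, mul_pow, mul_pow]
  have h1 : ‖deriv (deriv σ) (x i)‖ ^ 2 ≤ 1 := by
    have := hσ'' (x i)
    rw [← Real.norm_eq_abs] at this
    exact pow_le_one₀ (norm_nonneg _) this
  have h2 : ‖k i‖ ≤ ‖k‖ := PiLp.norm_apply_le k i
  calc _ ≤ 1 * (‖h i‖ ^ 2 * ‖k i‖ ^ 2) := by gcongr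
    _ ≤ _ := by rw [one_mul]; gcongr

/-- one layer, before activation -/
def preact (𝒜 : Matrix (Fin n) (Fin n) ℝ)
    (Ω W : EuclideanSpace ℝ (Fin d) →L[ℝ] EuclideanSpace ℝ (Fin d))
    (ψ : EuclideanSpace ℝ (Fin d) × EuclideanSpace ℝ (Fin d) → EuclideanSpace ℝ (Fin d))
    (F : Fin n → V → EuclideanSpace ℝ (Fin d)) (i : Fin n) (Z : V) : EuclideanSpace ℝ (Fin d) :=
  Ω (F i Z) + W (∑ u : Fin n, 𝒜 i u • ψ (F i Z, F u Z))

variable {𝒜 : Matrix (Fin n) (Fin n) ℝ}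
    {Ω W : EuclideanSpace ℝ (Fin d) →L[ℝ] EuclideanSpace ℝ (Fin d)}
    {ψ : EuclideanSpace ℝ (Fin d) × EuclideanSpace ℝ (Fin d) → EuclideanSpace ℝ (Fin d)}
    {F : Fin n → V → EuclideanSpace ℝ (Fin d)}

lemma preact_contDiff (hψ : ContDiff ℝ 2 ψ) (hF : ∀ i, ContDiff ℝ 2 (F i)) (i : Fin n) :
    ContDiff ℝ 2 (preact 𝒜 Ω W ψ F i) := by
  unfold preact
  have := hF i
  refine (Ω.contDiff.comp (hF i)).add (W.contDiff.comp (ContDiff.sum fun j _ => ?_))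
  exact (hψ.comp ((hF i).prodMk (hF j))).const_smul (𝒜 i j)

lemma preact_D1 (hψ : ContDiff ℝ 2 ψ) (hF : ∀ i, ContDiff ℝ 2 (F i)) (i : Fin n) (Y e : V) :
    fderiv ℝ (preact 𝒜 Ω W ψ F i) Y e = Ω (fderiv ℝ (F i) Y e)
      + W (∑ u, 𝒜 i u • fderiv ℝ ψ (F i Y, F u Y) (fderiv ℝ (F i) Y e, fderiv ℝ (F u) Y e)) := by
  have hc : ∀ j, ContDiff ℝ 2 (fun Z => ψ (F i Z, F j Z)) := fun j =>
    hψ.comp ((hF i).prodMk (hF j))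
  have hc' : ∀ j, ContDiff ℝ 2 (fun Z => 𝒜 i j • ψ (F i Z, F j Z)) := fun j =>
    (hc j).const_smul (𝒜 i j)
  have hs : ContDiff ℝ 2 (fun Z => ∑ j, 𝒜 i j • ψ (F i Z, F j Z)) :=
    ContDiff.sum fun j _ => hc' j
  change fderiv ℝ (fun Z => Ω (F i Z) + W (∑ u : Fin n, 𝒜 i u • ψ (F i Z, F u Z))) Y e = _
  have hO : ContDiff ℝ 2 (fun Z => Ω (F i Z)) := Ω.contDiff.comp (hF i)
  have hWW : ContDiff ℝ 2 (fun Z => W (∑ j, 𝒜 i j • ψ (F i Z, F j Z))) := W.contDiff.comp hs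
  rw [fderiv_fun_add (c2_diff hO Y) (c2_diff hWW Y)]
  rw [ContinuousLinearMap.add_apply, D1_clm Ω (hF i), D1_clm W hs, D1_sum _ hc']
  congr 2
  refine Finset.sum_congr rfl fun j _ => ?_
  rw [D1_smul _ (hc j)]
  congr 1
  rw [show (fun Z => ψ (F i Z, F j Z)) = ψ ∘ (fun Z => (F i Z, F j Z)) from rfl,
    fderiv_comp Y (c2_diff hψ _) (c2_diff ((hF i).prodMk (hF j)) Y), ContinuousLinearMap.comp_apply,
    D1_pair (hF i) (hF j)]

lemma preact_D2 (hψ : ContDiff ℝ 2 ψ) (hF : ∀ i, ContDiff ℝ 2 (F i)) (i : Fin n) (Y e e' : V) :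
    D2 (preact 𝒜 Ω W ψ F i) Y e e' = Ω (D2 (F i) Y e e')
      + W (∑ u, 𝒜 i u • (D2 ψ (F i Y, F u Y) (fderiv ℝ (F i) Y e, fderiv ℝ (F u) Y e)
            (fderiv ℝ (F i) Y e', fderiv ℝ (F u) Y e')
          + fderiv ℝ ψ (F i Y, F u Y) (D2 (F i) Y e e', D2 (F u) Y e e'))) := by
  have hc : ∀ j, ContDiff ℝ 2 (fun Z => ψ (F i Z, F j Z)) := fun j =>
    hψ.comp ((hF i).prodMk (hF j))
  have hc' : ∀ j, ContDiff ℝ 2 (fun Z => 𝒜 i j • ψ (F i Z, F j Z)) := fun j =>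
    (hc j).const_smul (𝒜 i j)
  have hs : ContDiff ℝ 2 (fun Z => ∑ j, 𝒜 i j • ψ (F i Z, F j Z)) :=
    ContDiff.sum fun j _ => hc' j
  change D2 (fun Z => Ω (F i Z) + W (∑ u : Fin n, 𝒜 i u • ψ (F i Z, F u Z))) Y e e' = _
  have hO : ContDiff ℝ 2 (fun Z => Ω (F i Z)) := Ω.contDiff.comp (hF i)
  have hWW : ContDiff ℝ 2 (fun Z => W (∑ j, 𝒜 i j • ψ (F i Z, F j Z))) := W.contDiff.comp hs
  rw [D2_add hO hWW, D2_clm Ω (hF i), D2_clm W hs,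
    D2_sum _ hc']
  congr 2
  refine Finset.sum_congr rfl fun j _ => ?_
  rw [D2_smul _ (hc j), D2_comp hψ ((hF i).prodMk (hF j)), D1_pair (hF i) (hF j),
    D1_pair (hF i) (hF j), D2_pair (hF i) (hF j)]

end Analytic

section Network

lemma pre_scalar {𝒜 : Matrix (Fin n) (Fin n) ℝ} (hA : ∀ i j, 0 ≤ 𝒜 i j) {γ : ℝ}
    (hrow : ∀ i, ∑ j, 𝒜 i j ≤ γ) {ω w c₁ c₂ : ℝ} (hw : 0 < w) (hw1 : w ≤ 1)
    (hc1 : 0 ≤ c₁) (hc2 : 0 ≤ c₂) (hc21 : c₂ ≤ 1)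
    (hcap : ω / w + c₁ * γ + c₂ ≤ 1) (a q : Fin n → ℝ) (ha : ∀ i, 0 ≤ a i) (hq : ∀ i, 0 ≤ q i)
    (i : Fin n) :
    ω * a i + w * ∑ j, 𝒜 i j * (q j + (c₁ * a i + c₂ * a j)) ≤
      (1 - c₂) * a i + c₂ * ∑ j, 𝒜 i j * a j + ∑ j, 𝒜 i j * q j := by
  have e : ∑ j, 𝒜 i j * (q j + (c₁ * a i + c₂ * a j))
      = ∑ j, 𝒜 i j * q j + (c₁ * a i * ∑ j, 𝒜 i j + c₂ * ∑ j, 𝒜 i j * a j) := by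
    rw [Finset.mul_sum, Finset.mul_sum, ← Finset.sum_add_distrib, ← Finset.sum_add_distrib]
    exact Finset.sum_congr rfl fun j _ => by ring
  have hQ : 0 ≤ ∑ j, 𝒜 i j * q j := Finset.sum_nonneg fun j _ => mul_nonneg (hA i j) (hq j)
  have hS : 0 ≤ ∑ j, 𝒜 i j * a j := Finset.sum_nonneg fun j _ => mul_nonneg (hA i j) (ha j)
  have hω : ω ≤ w * (1 - c₁ * γ - c₂) := by
    have : ω / w ≤ 1 - c₁ * γ - c₂ := by linarith
    rw [div_le_iff₀ hw] at this
    linarith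
  rw [e]
  have h1 : c₁ * a i * ∑ j, 𝒜 i j ≤ c₁ * a i * γ :=
    mul_le_mul_of_nonneg_left (hrow i) (mul_nonneg hc1 (ha i))
  have h2 : ω * a i ≤ w * (1 - c₁ * γ - c₂) * a i := mul_le_mul_of_nonneg_right hω (ha i)
  have h3 : w * (c₁ * a i * ∑ j, 𝒜 i j) ≤ w * (c₁ * a i * γ) :=
    mul_le_mul_of_nonneg_left h1 hw.le
  have h4 : w * ((1 - c₂) * a i) ≤ (1 - c₂) * a i :=
    mul_le_of_le_one_left (mul_nonneg (by linarith) (ha i)) hw1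
  have h5 : w * (c₂ * ∑ j, 𝒜 i j * a j) ≤ (c₂ * ∑ j, 𝒜 i j * a j) :=
    mul_le_of_le_one_left (mul_nonneg hc2 hS) hw1
  have h6 : w * (∑ j, 𝒜 i j * q j) ≤ (∑ j, 𝒜 i j * q j) :=
    mul_le_of_le_one_left hQ hw1
  nlinarith

variable {V : Type*} [NormedAddCommGroup V] [NormedSpace ℝ V]
    {𝒜 : Matrix (Fin n) (Fin n) ℝ}
    {Ω W : EuclideanSpace ℝ (Fin d) →L[ℝ] EuclideanSpace ℝ (Fin d)}
    {ψ : EuclideanSpace ℝ (Fin d) × EuclideanSpace ℝ (Fin d) → EuclideanSpace ℝ (Fin d)}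
    {F : Fin n → V → EuclideanSpace ℝ (Fin d)}

lemma pre_norm (hA : ∀ i j, 0 ≤ 𝒜 i j) {ω w : ℝ} (hw : 0 < w) (hΩ : ‖Ω‖ ≤ ω) (hW : ‖W‖ ≤ w)
    (x : EuclideanSpace ℝ (Fin d)) (y : Fin n → EuclideanSpace ℝ (Fin d)) (b : Fin n → ℝ)
    (hb : ∀ j, ‖y j‖ ≤ b j) (i : Fin n) :
    ‖Ω x + W (∑ j, 𝒜 i j • y j)‖ ≤ ω * ‖x‖ + w * ∑ j, 𝒜 i j * b j := by
  refine (norm_add_le _ _).trans (add_le_add ?_ ?_)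
  · exact (Ω.le_opNorm x).trans (mul_le_mul_of_nonneg_right hΩ (norm_nonneg _))
  · refine (W.le_opNorm _).trans ?_
    refine mul_le_mul hW ?_ (norm_nonneg _) hw.le
    refine (norm_sum_le _ _).trans (Finset.sum_le_sum fun j _ => ?_)
    rw [norm_smul, Real.norm_of_nonneg (hA i j)]
    exact mul_le_mul_of_nonneg_left (hb j) (hA i j)

lemma preact_D1_bound (hA : ∀ i j, 0 ≤ 𝒜 i j) {γ : ℝ}
    (hrow : ∀ i, ∑ j, 𝒜 i j ≤ γ) {ω w c₁ c₂ : ℝ} (hw : 0 < w) (hw1 : w ≤ 1)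
    (hc1 : 0 ≤ c₁) (hc2 : 0 ≤ c₂) (hc21 : c₂ ≤ 1)
    (hcap : ω / w + c₁ * γ + c₂ ≤ 1) (hΩ : ‖Ω‖ ≤ ω) (hW : ‖W‖ ≤ w)
    (hψ : ContDiff ℝ 2 ψ)
    (hψ₁ : ∀ x y, ‖fderiv ℝ (fun z => ψ (z, y)) x‖ ≤ c₁)
    (hψ₂ : ∀ x y, ‖fderiv ℝ (fun z => ψ (x, z)) y‖ ≤ c₂)
    (hF : ∀ i, ContDiff ℝ 2 (F i)) (i : Fin n) (Y e : V) :
    ‖fderiv ℝ (preact 𝒜 Ω W ψ F i) Y e‖ ≤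
      (1 - c₂) * ‖fderiv ℝ (F i) Y e‖ + c₂ * ∑ j, 𝒜 i j * ‖fderiv ℝ (F j) Y e‖ := by
  rw [preact_D1 hψ hF]
  have h := pre_scalar hA hrow hw hw1 hc1 hc2 hc21 hcap (fun j => ‖fderiv ℝ (F j) Y e‖)
    (fun _ => 0) (fun _ => norm_nonneg _) (fun _ => le_rfl) i
  simp only [mul_zero, Finset.sum_const_zero, add_zero, zero_add] at h
  exact (pre_norm hA hw hΩ hW _ _ _ (fun j => D1_psi_bound hψ hψ₁ hψ₂ _ _ _ _) i).trans h

lemma preact_D2_bound (hA : ∀ i j, 0 ≤ 𝒜 i j) {γ : ℝ}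
    (hrow : ∀ i, ∑ j, 𝒜 i j ≤ γ) {ω w c₁ c₂ c2 : ℝ} (hw : 0 < w) (hw1 : w ≤ 1)
    (hc1 : 0 ≤ c₁) (hc2 : 0 ≤ c₂) (hc21 : c₂ ≤ 1) (hc : 0 ≤ c2)
    (hcap : ω / w + c₁ * γ + c₂ ≤ 1) (hΩ : ‖Ω‖ ≤ ω) (hW : ‖W‖ ≤ w)
    (hψ : ContDiff ℝ 2 ψ)
    (hψ₁ : ∀ x y, ‖fderiv ℝ (fun z => ψ (z, y)) x‖ ≤ c₁)
    (hψ₂ : ∀ x y, ‖fderiv ℝ (fun z => ψ (x, z)) y‖ ≤ c₂)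
    (hψ₃ : ∀ p, ‖iteratedFDeriv ℝ 2 ψ p‖ ≤ c2)
    (hF : ∀ i, ContDiff ℝ 2 (F i)) (i : Fin n) (Y e e' : V) :
    ‖D2 (preact 𝒜 Ω W ψ F i) Y e e'‖ ≤
      (1 - c₂) * ‖D2 (F i) Y e e'‖ + c₂ * ∑ j, 𝒜 i j * ‖D2 (F j) Y e e'‖
      + ∑ j, 𝒜 i j * (c2 * ((‖fderiv ℝ (F i) Y e‖ + ‖fderiv ℝ (F j) Y e‖)
          * (‖fderiv ℝ (F i) Y e'‖ + ‖fderiv ℝ (F j) Y e'‖))) := by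
  rw [preact_D2 hψ hF]
  have h := pre_scalar hA hrow hw hw1 hc1 hc2 hc21 hcap (fun j => ‖D2 (F j) Y e e'‖)
    (fun j => c2 * ((‖fderiv ℝ (F i) Y e‖ + ‖fderiv ℝ (F j) Y e‖)
          * (‖fderiv ℝ (F i) Y e'‖ + ‖fderiv ℝ (F j) Y e'‖)))
    (fun _ => norm_nonneg _) (fun _ => by positivity) i
  refine (pre_norm hA hw hΩ hW _ _ _ (fun j => ?_) i).trans h
  refine (norm_add_le _ _).trans (add_le_add ?_ (D1_psi_bound hψ hψ₁ hψ₂ _ _ _ _))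
  refine (D2_iter_bound hψ hψ₃ _ _ _).trans (mul_le_mul_of_nonneg_left ?_ hc)
  exact mul_le_mul (norm_pair_le _ _) (norm_pair_le _ _) (norm_nonneg _) (by positivity)

/-- `(1-c₂) I + c₂ 𝒜` -/
def Zg (c₂ : ℝ) (𝒜 : Matrix (Fin n) (Fin n) ℝ) : Matrix (Fin n) (Fin n) ℝ :=
  (1 - c₂) • (1 : Matrix (Fin n) (Fin n) ℝ) + c₂ • 𝒜

lemma Zg_mul_apply (c₂ : ℝ) (𝒜 P : Matrix (Fin n) (Fin n) ℝ) (i u : Fin n) :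
    (Zg c₂ 𝒜 * P) i u = (1 - c₂) * P i u + c₂ * ∑ j, 𝒜 i j * P j u := by
  unfold Zg
  rw [add_mul, Matrix.smul_mul, Matrix.smul_mul, one_mul, Matrix.add_apply, Matrix.smul_apply,
    Matrix.smul_apply, Matrix.mul_apply]
  simp

lemma Zg_pow_nonneg {c₂ : ℝ} (hc2 : 0 ≤ c₂) (hc21 : c₂ ≤ 1) (hA : ∀ i j, 0 ≤ 𝒜 i j) (t : ℕ)
    (i u : Fin n) : 0 ≤ (Zg c₂ 𝒜 ^ t) i u := by
  induction t generalizing i with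
  | zero =>
    rw [pow_zero, Matrix.one_apply]
    split_ifs <;> norm_num
  | succ t ih =>
    rw [pow_succ', Zg_mul_apply]
    have : 0 ≤ ∑ j, 𝒜 i j * (Zg c₂ 𝒜 ^ t) j u :=
      Finset.sum_nonneg fun j _ => mul_nonneg (hA i j) (ih j)
    have h2 : 0 ≤ 1 - c₂ := by linarith
    have := ih i
    positivity

lemma network_bound (hA : ∀ i j, 0 ≤ 𝒜 i j) {γ : ℝ}
    (hrow : ∀ i, ∑ j, 𝒜 i j ≤ γ) {ω w c₁ c₂ c2 : ℝ} (hw : 0 < w) (hw1 : w ≤ 1)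
    (hc1 : 0 ≤ c₁) (hc2 : 0 ≤ c₂) (hc21 : c₂ ≤ 1) (hc : 0 ≤ c2)
    (hcap : ω / w + c₁ * γ + c₂ ≤ 1)
    (σ : ℝ → ℝ) (hσ : ContDiff ℝ 2 σ)
    (hσ' : ∀ x, |deriv σ x| ≤ 1) (hσ'' : ∀ x, |deriv (deriv σ) x| ≤ 1)
    (Ω W : ℕ → EuclideanSpace ℝ (Fin d) →L[ℝ] EuclideanSpace ℝ (Fin d))
    (hΩ : ∀ t, ‖Ω t‖ ≤ ω) (hW : ∀ t, ‖W t‖ ≤ w)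
    (ψ : ℕ → EuclideanSpace ℝ (Fin d) × EuclideanSpace ℝ (Fin d) → EuclideanSpace ℝ (Fin d))
    (hψ : ∀ t, ContDiff ℝ 2 (ψ t))
    (hψ₁ : ∀ t x y, ‖fderiv ℝ (fun z => ψ t (z, y)) x‖ ≤ c₁)
    (hψ₂ : ∀ t x y, ‖fderiv ℝ (fun z => ψ t (x, z)) y‖ ≤ c₂)
    (hψ₃ : ∀ t p, ‖iteratedFDeriv ℝ 2 (ψ t) p‖ ≤ c2)
    (s : Fin n → ℝ) (hs : ∀ i, 0 ≤ s i) (hsA : ∀ j, ∑ i, s i * 𝒜 i j = s j)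
    (v u : Fin n) (α β : Fin d) (X : Fin n → EuclideanSpace ℝ (Fin d)) (m : ℕ) :
    (∀ i, ContDiff ℝ 2 (fun Y => mpnn σ 𝒜 Ω W ψ m Y i)) ∧
    (∀ (i u : Fin n) (β : Fin d),
      ‖fderiv ℝ (fun Y => mpnn σ 𝒜 Ω W ψ m Y i) X (dir u β)‖ ≤ (Zg c₂ 𝒜 ^ m) i u) ∧
    ∑ i, s i * ‖D2 (fun Y => mpnn σ 𝒜 Ω W ψ m Y i) X (dir v α) (dir u β)‖ ≤
      ∑ t ∈ Finset.range m, ∑ i, s i * ((Zg c₂ 𝒜 ^ (t+1)) i v * (Zg c₂ 𝒜 ^ (t+1)) i u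
        + ∑ j, 𝒜 i j * (c2 * (((Zg c₂ 𝒜 ^ t) i v + (Zg c₂ 𝒜 ^ t) j v)
          * ((Zg c₂ 𝒜 ^ t) i u + (Zg c₂ 𝒜 ^ t) j u)))) := by
  induction m with
  | zero =>
    have hf : ∀ (i : Fin n) (Y : Fin n → EuclideanSpace ℝ (Fin d)),
        fderiv ℝ (fun Y : Fin n → EuclideanSpace ℝ (Fin d) => Y i) Y
          = ContinuousLinearMap.proj i := fun i Y =>
      (ContinuousLinearMap.proj (R := ℝ) (φ := fun _ : Fin n => EuclideanSpace ℝ (Fin d)) i).fderiv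
    refine ⟨fun i => ?_, fun i u β => ?_, ?_⟩
    · exact contDiff_apply ℝ _ i
    · change ‖fderiv ℝ (fun Y : Fin n → EuclideanSpace ℝ (Fin d) => Y i) X (dir u β)‖ ≤ _
      rw [hf, pow_zero, Matrix.one_apply]
      simp only [ContinuousLinearMap.proj_apply, dir]
      by_cases h : i = u
      · subst h; simp
      · simp [h]
    · have : ∀ i, D2 (fun Y => mpnn σ 𝒜 Ω W ψ 0 Y i) X (dir v α) (dir u β) = 0 := by
        intro i
        change fderiv ℝ (fun Z => fderiv ℝ
          (fun Y : Fin n → EuclideanSpace ℝ (Fin d) => Y i) Z (dir u β)) X (dir v α) = 0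
        simp only [hf]
        simp
      simp [this]
  | succ t ih =>
    obtain ⟨hF, h1, h2⟩ := ih
    set F : Fin n → (Fin n → EuclideanSpace ℝ (Fin d)) → EuclideanSpace ℝ (Fin d) :=
      fun i Y => mpnn σ 𝒜 Ω W ψ t Y i with hFdef
    have hrec : ∀ i, (fun Y => mpnn σ 𝒜 Ω W ψ (t+1) Y i)
        = fun Y => act σ (preact 𝒜 (Ω (t+1)) (W (t+1)) (ψ (t+1)) F i Y) := fun i => rfl
    have hp : ∀ i, ContDiff ℝ 2 (preact 𝒜 (Ω (t+1)) (W (t+1)) (ψ (t+1)) F i) :=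
      fun i => preact_contDiff (hψ _) hF i
    have hpb : ∀ i (u : Fin n) (β : Fin d),
        ‖fderiv ℝ (preact 𝒜 (Ω (t+1)) (W (t+1)) (ψ (t+1)) F i) X (dir u β)‖
          ≤ (Zg c₂ 𝒜 ^ (t+1)) i u := by
      intro i u β
      refine (preact_D1_bound hA hrow hw hw1 hc1 hc2 hc21 hcap (hΩ _) (hW _) (hψ _) (hψ₁ _)
        (hψ₂ _) hF i X (dir u β)).trans ?_
      rw [pow_succ', Zg_mul_apply]
      have h3 : 0 ≤ 1 - c₂ := by linarith
      refine add_le_add (mul_le_mul_of_nonneg_left (h1 i u β) h3)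
        (mul_le_mul_of_nonneg_left (Finset.sum_le_sum fun j _ => ?_) hc2)
      exact mul_le_mul_of_nonneg_left (h1 j u β) (hA i j)
    refine ⟨fun i => ?_, fun i u β => ?_, ?_⟩
    · rw [hrec]
      exact (act_contDiff hσ).comp (hp i)
    · rw [hrec]
      refine le_trans ?_ (hpb i u β)
      have := fderiv_comp X (g := act σ) (f := preact 𝒜 (Ω (t+1)) (W (t+1)) (ψ (t+1)) F i)
        (c2_diff (act_contDiff hσ) _) (c2_diff (hp i) _)
      change ‖fderiv ℝ (act σ ∘ preact 𝒜 (Ω (t+1)) (W (t+1)) (ψ (t+1)) F i) X (dir u β)‖ ≤ _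
      rw [this]
      exact act_D1_bound hσ hσ' _ _
    · rw [Finset.sum_range_succ]
      have key : ∀ i, ‖D2 (fun Y => mpnn σ 𝒜 Ω W ψ (t+1) Y i) X (dir v α) (dir u β)‖ ≤
          ((1 - c₂) * ‖D2 (F i) X (dir v α) (dir u β)‖
            + c₂ * ∑ j, 𝒜 i j * ‖D2 (F j) X (dir v α) (dir u β)‖)
          + ((Zg c₂ 𝒜 ^ (t+1)) i v * (Zg c₂ 𝒜 ^ (t+1)) i u
        + ∑ j, 𝒜 i j * (c2 * (((Zg c₂ 𝒜 ^ t) i v + (Zg c₂ 𝒜 ^ t) j v)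
          * ((Zg c₂ 𝒜 ^ t) i u + (Zg c₂ 𝒜 ^ t) j u)))) := by
        intro i
        rw [hrec, D2_comp (act_contDiff hσ) (hp i)]
        refine (norm_add_le _ _).trans ?_
        have ha := (act_D2_bound hσ hσ'' (preact 𝒜 (Ω (t+1)) (W (t+1)) (ψ (t+1)) F i X)
          (fderiv ℝ (preact 𝒜 (Ω (t+1)) (W (t+1)) (ψ (t+1)) F i) X (dir v α))
          (fderiv ℝ (preact 𝒜 (Ω (t+1)) (W (t+1)) (ψ (t+1)) F i) X (dir u β))).trans
          (mul_le_mul (hpb i v α) (hpb i u β) (norm_nonneg _)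
            (Zg_pow_nonneg hc2 hc21 hA _ _ _))
        have hb := (act_D1_bound hσ hσ' (preact 𝒜 (Ω (t+1)) (W (t+1)) (ψ (t+1)) F i X)
          (D2 (preact 𝒜 (Ω (t+1)) (W (t+1)) (ψ (t+1)) F i) X (dir v α) (dir u β))).trans
          (preact_D2_bound hA hrow hw hw1 hc1 hc2 hc21 hc hcap (hΩ _) (hW _) (hψ _) (hψ₁ _)
            (hψ₂ _) (hψ₃ _) hF i X (dir v α) (dir u β))
        have hcc : ∑ j, 𝒜 i j * (c2 * ((‖fderiv ℝ (F i) X (dir v α)‖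
              + ‖fderiv ℝ (F j) X (dir v α)‖)
            * (‖fderiv ℝ (F i) X (dir u β)‖ + ‖fderiv ℝ (F j) X (dir u β)‖)))
            ≤ ∑ j, 𝒜 i j * (c2 * (((Zg c₂ 𝒜 ^ t) i v + (Zg c₂ 𝒜 ^ t) j v)
          * ((Zg c₂ 𝒜 ^ t) i u + (Zg c₂ 𝒜 ^ t) j u))) := by
          refine Finset.sum_le_sum fun j _ => ?_
          refine mul_le_mul_of_nonneg_left (mul_le_mul_of_nonneg_left ?_ hc) (hA i j)
          exact mul_le_mul (add_le_add (h1 i v α) (h1 j v α)) (add_le_add (h1 i u β) (h1 j u β))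
            (by positivity) (add_nonneg (Zg_pow_nonneg hc2 hc21 hA _ _ _)
              (Zg_pow_nonneg hc2 hc21 hA _ _ _))
        linarith
      have h4 : ∑ i, s i * ((1 - c₂) * ‖D2 (F i) X (dir v α) (dir u β)‖
            + c₂ * ∑ j, 𝒜 i j * ‖D2 (F j) X (dir v α) (dir u β)‖)
          = ∑ i, s i * ‖D2 (F i) X (dir v α) (dir u β)‖ := by
        have h5 : ∑ i, s i * (∑ j, 𝒜 i j * ‖D2 (F j) X (dir v α) (dir u β)‖)
            = ∑ j, s j * ‖D2 (F j) X (dir v α) (dir u β)‖ := by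
          simp_rw [Finset.mul_sum]
          rw [Finset.sum_comm]
          refine Finset.sum_congr rfl fun j _ => ?_
          simp_rw [← mul_assoc]
          rw [← Finset.sum_mul, hsA]
        calc _ = (1 - c₂) * ∑ i, s i * ‖D2 (F i) X (dir v α) (dir u β)‖
              + c₂ * ∑ i, s i * (∑ j, 𝒜 i j * ‖D2 (F j) X (dir v α) (dir u β)‖) := by
              rw [Finset.mul_sum, Finset.mul_sum, ← Finset.sum_add_distrib]
              exact Finset.sum_congr rfl fun i _ => by ring
          _ = _ := by rw [h5]; ring
      calc _ ≤ ∑ i, s i * (_ + _) :=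
            Finset.sum_le_sum fun i _ => mul_le_mul_of_nonneg_left (key i) (hs i)
        _ = _ + _ := by
            simp_rw [mul_add (s _)]
            rw [Finset.sum_add_distrib]
        _ ≤ _ := by
            refine add_le_add ?_ ?_
            · simp_rw [← mul_add (s _)]
              rw [h4]
              exact h2
            · simp_rw [← mul_add (s _)]
              exact le_rfl

lemma mix_le (θ : EuclideanSpace ℝ (Fin d)) (hθ : ‖θ‖ = 1) (σ : ℝ → ℝ)
    (Ω W : ℕ → EuclideanSpace ℝ (Fin d) →L[ℝ] EuclideanSpace ℝ (Fin d))
    (ψ : ℕ → EuclideanSpace ℝ (Fin d) × EuclideanSpace ℝ (Fin d) → EuclideanSpace ℝ (Fin d))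
    (m : ℕ) (v u : Fin n) (X : Fin n → EuclideanSpace ℝ (Fin d)) (α β : Fin d)
    (hC : ∀ i, ContDiff ℝ 2 (fun Y => mpnn σ 𝒜 Ω W ψ m Y i)) :
    |mixEntry θ σ 𝒜 Ω W ψ m v u X α β| ≤
      ∑ i, ‖D2 (fun Y => mpnn σ 𝒜 Ω W ψ m Y i) X (dir v α) (dir u β)‖ := by
  have h0 : (fun Z => readout θ σ 𝒜 Ω W ψ m Z)
      = fun Z => innerSL ℝ θ (∑ i, mpnn σ 𝒜 Ω W ψ m Z i) := by
    funext Z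
    rw [innerSL_apply_apply, PiLp.inner_apply]
    unfold readout
    refine Finset.sum_congr rfl fun a _ => ?_
    simp [mul_comm]
  have h1 : mixEntry θ σ 𝒜 Ω W ψ m v u X α β
      = D2 (fun Z => readout θ σ 𝒜 Ω W ψ m Z) X (dir v α) (dir u β) := rfl
  have hs : ContDiff ℝ 2 (fun Z => ∑ i, mpnn σ 𝒜 Ω W ψ m Z i) := ContDiff.sum fun i _ => hC i
  rw [h1, h0, D2_clm _ hs, D2_sum _ hC, ← Real.norm_eq_abs]
  refine (ContinuousLinearMap.le_opNorm _ _).trans ?_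
  rw [innerSL_apply_norm, hθ, one_mul]
  exact norm_sum_le _ _

end Network

section Spectral

lemma sum_split_zero (h0 : 0 < n) (f : Fin n → ℝ) :
    ∑ ℓ, f ℓ = f ⟨0, h0⟩ + ∑ ℓ ∈ Finset.univ.filter (fun ℓ : Fin n => (ℓ : ℕ) ≠ 0), f ℓ := by
  rw [← Finset.add_sum_erase Finset.univ f (Finset.mem_univ ⟨0, h0⟩)]
  congr 2
  ext ℓ
  simp [Fin.ext_iff]

lemma complete_of_orth {φ : Fin n → Fin n → ℝ}
    (horth : ∀ k l, ∑ a, φ k a * φ l a = if k = l then (1 : ℝ) else 0) (a b : Fin n) :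
    ∑ ℓ, φ ℓ a * φ ℓ b = if a = b then (1 : ℝ) else 0 := by
  have h : (Matrix.of φ) * (Matrix.of φ).transpose = 1 := by
    ext k l
    rw [Matrix.mul_apply, Matrix.one_apply, ← horth k l]
    rfl
  have h2 := mul_eq_one_comm.1 h
  have h3 := congrFun (congrFun h2 a) b
  rw [Matrix.mul_apply, Matrix.one_apply] at h3
  exact h3

lemma Zg_spectral {𝒜 : Matrix (Fin n) (Fin n) ℝ} {φ : Fin n → Fin n → ℝ} {lam : Fin n → ℝ}
    (horth : ∀ k l, ∑ a, φ k a * φ l a = if k = l then (1 : ℝ) else 0)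
    (heig : ∀ ℓ i, ∑ j, 𝒜 i j * φ ℓ j = (1 - lam ℓ) * φ ℓ i) (c₂ : ℝ) (t : ℕ) (i u : Fin n) :
    (Zg c₂ 𝒜 ^ t) i u = ∑ ℓ, (1 - c₂ * lam ℓ) ^ t * (φ ℓ i * φ ℓ u) := by
  induction t generalizing i with
  | zero => simp [Matrix.one_apply, complete_of_orth horth]
  | succ t ih =>
    rw [pow_succ', Zg_mul_apply]
    simp_rw [ih, Finset.mul_sum]
    rw [Finset.sum_comm, ← Finset.sum_add_distrib]
    refine Finset.sum_congr rfl fun ℓ _ => ?_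
    have : ∑ j, c₂ * (𝒜 i j * ((1 - c₂ * lam ℓ) ^ t * (φ ℓ j * φ ℓ u)))
        = c₂ * (1 - c₂ * lam ℓ) ^ t * φ ℓ u * ∑ j, 𝒜 i j * φ ℓ j := by
      rw [Finset.mul_sum]
      exact Finset.sum_congr rfl fun j _ => by ring
    rw [this, heig]
    ring

lemma Asym_apply (G : SimpleGraph (Fin n)) [DecidableRel G.Adj] (i j : Fin n) :
    Asym G i j = if G.Adj i j then (Real.sqrt (G.degree i))⁻¹ * (Real.sqrt (G.degree j))⁻¹ else 0 := by
  unfold Asym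
  rw [Matrix.mul_diagonal, Matrix.diagonal_mul, SimpleGraph.adjMatrix_apply]
  split_ifs <;> simp

lemma Asym_nonneg (G : SimpleGraph (Fin n)) [DecidableRel G.Adj] (i j : Fin n) :
    0 ≤ Asym G i j := by
  rw [Asym_apply]
  split_ifs <;> positivity

lemma Asym_symm (G : SimpleGraph (Fin n)) [DecidableRel G.Adj] (i j : Fin n) :
    Asym G i j = Asym G j i := by
  rw [Asym_apply, Asym_apply]
  by_cases h : G.Adj i j
  · rw [if_pos h, if_pos h.symm, mul_comm]
  · rw [if_neg h, if_neg (fun h' => h h'.symm)]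

lemma sum_adj (G : SimpleGraph (Fin n)) [DecidableRel G.Adj] (i : Fin n) (c : ℝ) :
    ∑ j, (if G.Adj i j then c else 0) = G.degree i * c := by
  rw [← Finset.sum_filter, Finset.sum_const, nsmul_eq_mul]
  congr 2
  rw [← SimpleGraph.card_neighborFinset_eq_degree]
  congr 1
  ext j
  simp

lemma Asym_stat (G : SimpleGraph (Fin n)) [DecidableRel G.Adj] (hpos : ∀ i, 0 < G.degree i)
    (j : Fin n) : ∑ i, Real.sqrt (G.degree i) * Asym G i j = Real.sqrt (G.degree j) := by
  have h : ∀ i, Real.sqrt (G.degree i) * Asym G i j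
      = if G.Adj j i then (Real.sqrt (G.degree j))⁻¹ else 0 := by
    intro i
    rw [Asym_symm, Asym_apply]
    have : Real.sqrt (G.degree i) ≠ 0 :=
      (Real.sqrt_pos.2 (Nat.cast_pos.2 (hpos i))).ne'
    split_ifs
    · rw [mul_left_comm, mul_inv_cancel₀ this, mul_one]
    · simp
  simp_rw [h]
  rw [sum_adj, ← div_eq_mul_inv, Real.div_sqrt]

lemma Asym_row (G : SimpleGraph (Fin n)) [DecidableRel G.Adj] (hpos : ∀ i, 0 < G.degree i)
    {γ : ℝ} (hγ : ∀ i j : Fin n, Real.sqrt (G.degree i) / Real.sqrt (G.degree j) ≤ γ)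
    (i : Fin n) : ∑ j, Asym G i j ≤ γ := by
  have hi : (0 : ℝ) < G.degree i := Nat.cast_pos.2 (hpos i)
  have hsi : 0 < Real.sqrt (G.degree i) := Real.sqrt_pos.2 hi
  have h : ∀ j, Asym G i j ≤ if G.Adj i j then γ / G.degree i else 0 := by
    intro j
    rw [Asym_apply]
    split_ifs
    · rw [le_div_iff₀ hi]
      refine le_trans (le_of_eq ?_) (hγ i j)
      have := Real.mul_self_sqrt hi.le
      rw [div_eq_mul_inv]
      calc _ = (Real.sqrt (G.degree i))⁻¹ * (Real.sqrt (G.degree j))⁻¹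
            * (Real.sqrt (G.degree i) * Real.sqrt (G.degree i)) := by rw [this]
        _ = _ := by field_simp
    · exact le_rfl
  refine (Finset.sum_le_sum fun j _ => h j).trans (le_of_eq ?_)
  rw [sum_adj]
  field_simp

lemma Zg_zero (G : SimpleGraph (Fin n)) [DecidableRel G.Adj] (hconn : G.Connected) (c₂ : ℝ)
    (t : ℕ) (i u : Fin n) (h : t < G.dist i u) : (Zg c₂ (Asym G) ^ t) i u = 0 := by
  induction t generalizing i with
  | zero =>
    rw [pow_zero, Matrix.one_apply, if_neg]
    rintro rfl
    simp at h
  | succ t ih =>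
    rw [pow_succ', Zg_mul_apply, ih i (by omega)]
    rw [Finset.sum_eq_zero]
    · simp
    · intro j _
      by_cases hij : G.Adj i j
      · have h1 := hconn.dist_triangle (u := i) (v := j) (w := u)
        rw [SimpleGraph.dist_eq_one_iff_adj.2 hij] at h1
        rw [ih j (by omega), mul_zero]
      · rw [Asym_apply, if_neg hij, zero_mul]

lemma layer_sum_bound {𝒜 : Matrix (Fin n) (Fin n) ℝ} (hA : ∀ i j, 0 ≤ 𝒜 i j)
    (hsym : ∀ i j, 𝒜 i j = 𝒜 j i) {γ : ℝ} (hrow : ∀ i, ∑ j, 𝒜 i j ≤ γ)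
    (s : Fin n → ℝ) (hs : ∀ i, 0 ≤ s i) (hsA : ∀ j, ∑ i, s i * 𝒜 i j = s j)
    {S : ℝ} (hsS : ∀ i, s i ≤ S) (a b : Fin n → ℝ) (ha : ∀ i, 0 ≤ a i) (hb : ∀ i, 0 ≤ b i) :
    ∑ i, s i * ∑ j, 𝒜 i j * ((a i + a j) * (b i + b j)) ≤
      S * ((1 + γ) * ∑ i, a i * b i + 2 * ∑ i, a i * ∑ j, 𝒜 i j * b j) := by
  have h1 : ∑ i, s i * ((∑ j, 𝒜 i j) * (a i * b i)) ≤ S * (γ * ∑ i, a i * b i) := by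
    rw [Finset.mul_sum, Finset.mul_sum]
    refine Finset.sum_le_sum fun i _ => ?_
    have hab := mul_nonneg (ha i) (hb i)
    have hr : 0 ≤ ∑ j, 𝒜 i j := Finset.sum_nonneg fun j _ => hA i j
    exact mul_le_mul (hsS i) (mul_le_mul_of_nonneg_right (hrow i) hab)
      (mul_nonneg hr hab) ((hs i).trans (hsS i))
  have h2 : ∑ i, s i * ∑ j, 𝒜 i j * (a j * b j) ≤ S * ∑ i, a i * b i := by
    have : ∑ i, s i * ∑ j, 𝒜 i j * (a j * b j) = ∑ j, s j * (a j * b j) := by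
      simp_rw [Finset.mul_sum]
      rw [Finset.sum_comm]
      refine Finset.sum_congr rfl fun j _ => ?_
      simp_rw [← mul_assoc (s _)]
      rw [← Finset.sum_mul, hsA, mul_assoc]
    rw [this, Finset.mul_sum]
    exact Finset.sum_le_sum fun i _ =>
      mul_le_mul_of_nonneg_right (hsS i) (mul_nonneg (ha i) (hb i))
  have h3 : ∑ i, s i * (a i * ∑ j, 𝒜 i j * b j) ≤ S * ∑ i, a i * ∑ j, 𝒜 i j * b j := by
    rw [Finset.mul_sum]
    exact Finset.sum_le_sum fun i _ => mul_le_mul_of_nonneg_right (hsS i)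
      (mul_nonneg (ha i) (Finset.sum_nonneg fun j _ => mul_nonneg (hA i j) (hb j)))
  have h4 : ∑ i, s i * (b i * ∑ j, 𝒜 i j * a j) ≤ S * ∑ i, a i * ∑ j, 𝒜 i j * b j := by
    have e : ∑ i, a i * ∑ j, 𝒜 i j * b j = ∑ i, b i * ∑ j, 𝒜 i j * a j := by
      simp_rw [Finset.mul_sum]
      rw [Finset.sum_comm]
      refine Finset.sum_congr rfl fun j _ => Finset.sum_congr rfl fun i _ => ?_
      rw [hsym i j]; ring
    rw [e, Finset.mul_sum]
    exact Finset.sum_le_sum fun i _ => mul_le_mul_of_nonneg_right (hsS i)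
      (mul_nonneg (hb i) (Finset.sum_nonneg fun j _ => mul_nonneg (hA i j) (ha j)))
  have e : ∑ i, s i * ∑ j, 𝒜 i j * ((a i + a j) * (b i + b j))
      = ∑ i, s i * ((∑ j, 𝒜 i j) * (a i * b i)) + ∑ i, s i * ∑ j, 𝒜 i j * (a j * b j)
        + ∑ i, s i * (a i * ∑ j, 𝒜 i j * b j) + ∑ i, s i * (b i * ∑ j, 𝒜 i j * a j) := by
    rw [← Finset.sum_add_distrib, ← Finset.sum_add_distrib, ← Finset.sum_add_distrib]
    refine Finset.sum_congr rfl fun i _ => ?_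
    rw [← mul_add, ← mul_add, ← mul_add, Finset.sum_mul, Finset.mul_sum (a := a i),
      Finset.mul_sum (a := b i),
      ← Finset.sum_add_distrib, ← Finset.sum_add_distrib, ← Finset.sum_add_distrib]
    congr 1
    exact Finset.sum_congr rfl fun j _ => by ring
  rw [e]
  linarith

lemma Zg_pow_symm {𝒜 : Matrix (Fin n) (Fin n) ℝ} (hsym : ∀ i j, 𝒜 i j = 𝒜 j i) (c₂ : ℝ) (t : ℕ)
    (i j : Fin n) : (Zg c₂ 𝒜 ^ t) i j = (Zg c₂ 𝒜 ^ t) j i := by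
  have h : (Zg c₂ 𝒜).transpose = Zg c₂ 𝒜 := by
    ext i j
    simp only [Zg, Matrix.transpose_apply, Matrix.add_apply, Matrix.smul_apply, hsym j i,
      Matrix.one_apply, eq_comm]
  have h2 := Matrix.transpose_pow (Zg c₂ 𝒜) t
  rw [h] at h2
  exact congrFun (congrFun h2 j) i

/-- `(Zᵗ A Zᵗ)_{vu} = (A Z²ᵗ)_{vu}`, cleared of `c₂`. -/
lemma Zg_AZ {𝒜 : Matrix (Fin n) (Fin n) ℝ} (hsym : ∀ i j, 𝒜 i j = 𝒜 j i) (c₂ : ℝ) (t : ℕ)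
    (v u : Fin n) :
    c₂ * ∑ i, (Zg c₂ 𝒜 ^ t) i v * ∑ j, 𝒜 i j * (Zg c₂ 𝒜 ^ t) j u
      = (Zg c₂ 𝒜 ^ (2 * t + 1)) v u - (1 - c₂) * (Zg c₂ 𝒜 ^ (2 * t)) v u := by
  have h1 : Zg c₂ 𝒜 ^ (2 * t + 1) = Zg c₂ 𝒜 ^ t * (Zg c₂ 𝒜 * Zg c₂ 𝒜 ^ t) := by
    rw [← pow_succ', ← pow_add]; congr 1; omega
  have h2 : Zg c₂ 𝒜 ^ (2 * t) = Zg c₂ 𝒜 ^ t * Zg c₂ 𝒜 ^ t := by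
    rw [← pow_add]; congr 1; omega
  rw [h1, h2, Matrix.mul_apply, Matrix.mul_apply]
  simp_rw [Zg_mul_apply]
  rw [Finset.mul_sum, Finset.mul_sum, ← Finset.sum_sub_distrib]
  refine Finset.sum_congr rfl fun i _ => ?_
  rw [Zg_pow_symm hsym c₂ t v i]
  ring

lemma Zg_sq {𝒜 : Matrix (Fin n) (Fin n) ℝ} (hsym : ∀ i j, 𝒜 i j = 𝒜 j i) (c₂ : ℝ) (t : ℕ)
    (v u : Fin n) :
    ∑ i, (Zg c₂ 𝒜 ^ t) i v * (Zg c₂ 𝒜 ^ t) i u = (Zg c₂ 𝒜 ^ (2 * t)) v u := by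
  have h2 : Zg c₂ 𝒜 ^ (2 * t) = Zg c₂ 𝒜 ^ t * Zg c₂ 𝒜 ^ t := by
    rw [← pow_add]; congr 1; omega
  rw [h2, Matrix.mul_apply]
  exact Finset.sum_congr rfl fun i _ => by rw [Zg_pow_symm hsym c₂ t v i]

/-- the double sum of the network bound, in terms of powers of `Z`. -/
lemma total_bound {𝒜 : Matrix (Fin n) (Fin n) ℝ} (hA : ∀ i j, 0 ≤ 𝒜 i j)
    (hsym : ∀ i j, 𝒜 i j = 𝒜 j i) {γ : ℝ} (hrow : ∀ i, ∑ j, 𝒜 i j ≤ γ)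
    (s : Fin n → ℝ) (hs : ∀ i, 0 ≤ s i) (hsA : ∀ j, ∑ i, s i * 𝒜 i j = s j)
    {S : ℝ} (hsS : ∀ i, s i ≤ S) {c₂ c2 : ℝ} (hc2 : 0 < c₂) (hc21 : c₂ ≤ 1) (hc : 0 ≤ c2)
    (v u : Fin n) (t : ℕ) :
    ∑ i, s i * ((Zg c₂ 𝒜 ^ (t+1)) i v * (Zg c₂ 𝒜 ^ (t+1)) i u
        + ∑ j, 𝒜 i j * (c2 * (((Zg c₂ 𝒜 ^ t) i v + (Zg c₂ 𝒜 ^ t) j v)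
          * ((Zg c₂ 𝒜 ^ t) i u + (Zg c₂ 𝒜 ^ t) j u)))) ≤
    S * ((Zg c₂ 𝒜 ^ (2 * t + 2)) v u + c2 * ((1 + γ) * (Zg c₂ 𝒜 ^ (2 * t)) v u
      + 2 * ((Zg c₂ 𝒜 ^ (2 * t)) v u
        + ((Zg c₂ 𝒜 ^ (2 * t + 1)) v u - (Zg c₂ 𝒜 ^ (2 * t)) v u) / c₂))) := by
  have hZ := fun t i u => Zg_pow_nonneg (𝒜 := 𝒜) hc2.le hc21 hA t i u
  have h1 : ∑ i, s i * ((Zg c₂ 𝒜 ^ (t+1)) i v * (Zg c₂ 𝒜 ^ (t+1)) i u)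
      ≤ S * (Zg c₂ 𝒜 ^ (2 * t + 2)) v u := by
    rw [show 2 * t + 2 = 2 * (t + 1) by ring, ← Zg_sq hsym, Finset.mul_sum]
    exact Finset.sum_le_sum fun i _ => mul_le_mul_of_nonneg_right (hsS i)
      (mul_nonneg (hZ _ _ _) (hZ _ _ _))
  have h2 := layer_sum_bound hA hsym hrow s hs hsA hsS (fun i => (Zg c₂ 𝒜 ^ t) i v)
    (fun i => (Zg c₂ 𝒜 ^ t) i u) (fun i => hZ _ _ _) (fun i => hZ _ _ _)
  have h3 : ∑ i, (Zg c₂ 𝒜 ^ t) i v * ∑ j, 𝒜 i j * (Zg c₂ 𝒜 ^ t) j u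
      = (Zg c₂ 𝒜 ^ (2 * t)) v u
        + ((Zg c₂ 𝒜 ^ (2 * t + 1)) v u - (Zg c₂ 𝒜 ^ (2 * t)) v u) / c₂ := by
    have := Zg_AZ hsym c₂ t v u
    field_simp
    linarith
  rw [h3, Zg_sq hsym] at h2
  have e : ∑ i, s i * ((Zg c₂ 𝒜 ^ (t+1)) i v * (Zg c₂ 𝒜 ^ (t+1)) i u
        + ∑ j, 𝒜 i j * (c2 * (((Zg c₂ 𝒜 ^ t) i v + (Zg c₂ 𝒜 ^ t) j v)
          * ((Zg c₂ 𝒜 ^ t) i u + (Zg c₂ 𝒜 ^ t) j u))))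
      = ∑ i, s i * ((Zg c₂ 𝒜 ^ (t+1)) i v * (Zg c₂ 𝒜 ^ (t+1)) i u)
       + c2 * ∑ i, s i * ∑ j, 𝒜 i j * (((Zg c₂ 𝒜 ^ t) i v + (Zg c₂ 𝒜 ^ t) j v)
          * ((Zg c₂ 𝒜 ^ t) i u + (Zg c₂ 𝒜 ^ t) j u)) := by
    rw [Finset.mul_sum, ← Finset.sum_add_distrib]
    refine Finset.sum_congr rfl fun i _ => ?_
    rw [mul_add, mul_left_comm c2, Finset.mul_sum (a := c2)]
    congr 2
    exact Finset.sum_congr rfl fun j _ => by ring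
  rw [e]
  have h4 := mul_le_mul_of_nonneg_left h2 hc
  calc _ ≤ _ := add_le_add h1 h4
    _ = _ := by ring

/-- summing over layers: scalar statement about the sequence `z t = (Zᵗ)_{vu}`. -/
lemma seq_bound (z : ℕ → ℝ) (hz : ∀ t, 0 ≤ z t) (hz0 : z 0 = 0) {c₂ c2 γ : ℝ} (hc2 : 0 < c₂)
    (hc : 0 ≤ c2) (hγ : 1 ≤ γ) (hmon : ∀ t, (1 - c₂) * z t ≤ z (t+1)) (m : ℕ) :
    ∑ t ∈ Finset.range m, (z (2*t+2) + c2 * ((1 + γ) * z (2*t)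
      + 2 * (z (2*t) + (z (2*t+1) - z (2*t)) / c₂)))
    ≤ ∑ t ∈ Finset.range (2*m+1), z t + 2 * c2 * (1 + γ) * ∑ t ∈ Finset.range (2*m), z t
      + 2 * c2 * z (2*m) / c₂ := by
  have ha : ∀ t, 0 ≤ z t + (z (t+1) - z t) / c₂ := by
    intro t
    have := hmon t
    have h : z t + (z (t+1) - z t) / c₂ = (z (t+1) - (1 - c₂) * z t) / c₂ := by
      field_simp; ring
    rw [h]
    exact div_nonneg (by linarith) hc2.le
  induction m with
  | zero => simp [hz0]
  | succ m ih =>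
    rw [Finset.sum_range_succ]
    rw [show 2 * (m+1) + 1 = 2*m+1+1+1 by ring, Finset.sum_range_succ, Finset.sum_range_succ]
    rw [show 2 * (m+1) = 2*m+1+1 by ring, Finset.sum_range_succ _ (2*m+1),
      Finset.sum_range_succ _ (2*m)]
    have h1 := hz (2*m+1)
    have h2 := mul_nonneg hc (ha (2*m+1))
    have h3 := mul_nonneg hc (hz (2*m))
    have h4 := mul_nonneg hc (hz (2*m+1))
    have h5 := mul_nonneg h3 (by linarith : 0 ≤ γ - 1)
    have h6 := mul_nonneg h4 (by linarith : 0 ≤ γ)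
    have e1 : 2 * c2 * z (2*m+1+1) / c₂ = 2 * c2 * z (2*m) / c₂
      + 2 * c2 * ((z (2*m+1) - z (2*m)) / c₂) + 2 * c2 * ((z (2*m+1+1) - z (2*m+1)) / c₂) := by
      field_simp; ring
    rw [e1]
    rw [Finset.sum_range_succ] at ih
    rw [show 2*m+2 = 2*m+1+1 from rfl]
    nlinarith

end Spectral

section Final

variable {φ : Fin n → Fin n → ℝ} {lam : Fin n → ℝ}

lemma two_le_sq (x y : ℝ) : |x * y| ≤ (x ^ 2 + y ^ 2) / 2 := by
  rw [abs_le]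
  constructor <;> nlinarith [sq_nonneg (x - y), sq_nonneg (x + y)]

lemma sum_sq_nontriv (h0 : 0 < n)
    (horth : ∀ k l, ∑ a, φ k a * φ l a = if k = l then (1 : ℝ) else 0) (v u : Fin n) :
    ∑ ℓ ∈ Finset.univ.filter (fun ℓ : Fin n => (ℓ : ℕ) ≠ 0), (φ ℓ v ^ 2 + φ ℓ u ^ 2) / 2
      ≤ 1 - φ ⟨0, h0⟩ v * φ ⟨0, h0⟩ u := by
  have h1 : ∑ ℓ, (φ ℓ v ^ 2 + φ ℓ u ^ 2) / 2 = 1 := by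
    rw [← Finset.sum_div, Finset.sum_add_distrib]
    have hv := complete_of_orth horth v v
    have hu := complete_of_orth horth u u
    simp only [if_true, ← pow_two] at hv hu
    rw [hv, hu]; norm_num
  rw [sum_split_zero h0] at h1
  nlinarith [sq_nonneg (φ ⟨0, h0⟩ v - φ ⟨0, h0⟩ u)]

lemma partial_sum_bound {𝒜 : Matrix (Fin n) (Fin n) ℝ} (h0 : 0 < n) (hn : 1 < n)
    (horth : ∀ k l, ∑ a, φ k a * φ l a = if k = l then (1 : ℝ) else 0)
    (heig : ∀ ℓ i, ∑ j, 𝒜 i j * φ ℓ j = (1 - lam ℓ) * φ ℓ i)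
    (hmono : Monotone lam) (hlam0 : lam ⟨0, h0⟩ = 0)
    (hlampos : ∀ ℓ : Fin n, (ℓ : ℕ) ≠ 0 → 0 < lam ℓ)
    {c₂ Λ : ℝ} (hc2 : 0 < c₂) (hΛ : ∀ ℓ : Fin n, (ℓ : ℕ) ≠ 0 → |1 - c₂ * lam ℓ| ≤ Λ)
    (v u : Fin n) (N : ℕ) :
    ∑ t ∈ Finset.range N, (Zg c₂ 𝒜 ^ t) v u ≤
      N * (φ ⟨0, h0⟩ v * φ ⟨0, h0⟩ u)
      + (∑ ℓ ∈ Finset.univ.filter (fun ℓ : Fin n => (ℓ : ℕ) ≠ 0), (1 / lam ℓ) * (φ ℓ v * φ ℓ u)) / c₂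
      + Λ ^ N * (1 - φ ⟨0, h0⟩ v * φ ⟨0, h0⟩ u) / (c₂ * lam ⟨1, hn⟩) := by
  have hl1 : 0 < lam ⟨1, hn⟩ := hlampos _ (by simp)
  have hΛ0 : 0 ≤ Λ := (abs_nonneg _).trans (hΛ ⟨1, hn⟩ (by simp))
  have e1 : ∑ t ∈ Finset.range N, (Zg c₂ 𝒜 ^ t) v u
      = ∑ ℓ, (∑ t ∈ Finset.range N, (1 - c₂ * lam ℓ) ^ t) * (φ ℓ v * φ ℓ u) := by
    simp_rw [Zg_spectral horth heig c₂]
    rw [Finset.sum_comm]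
    exact Finset.sum_congr rfl fun ℓ _ => by rw [Finset.sum_mul]
  rw [e1, sum_split_zero h0, hlam0]
  simp only [mul_zero, sub_zero, one_pow, Finset.sum_const, Finset.card_range, nsmul_eq_mul,
    mul_one]
  rw [add_assoc]
  refine add_le_add le_rfl ?_
  have h2 : Λ ^ N * (∑ ℓ ∈ Finset.univ.filter (fun ℓ : Fin n => (ℓ : ℕ) ≠ 0),
      (φ ℓ v ^ 2 + φ ℓ u ^ 2) / 2) / (c₂ * lam ⟨1, hn⟩)
      ≤ Λ ^ N * (1 - φ ⟨0, h0⟩ v * φ ⟨0, h0⟩ u) / (c₂ * lam ⟨1, hn⟩) := by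
    have := sum_sq_nontriv h0 horth v u
    gcongr
  refine le_trans ?_ (add_le_add le_rfl h2)
  rw [Finset.sum_div, Finset.mul_sum, Finset.sum_div, ← Finset.sum_add_distrib]
  refine Finset.sum_le_sum fun ℓ hℓ => ?_
  have hℓ0 : (ℓ : ℕ) ≠ 0 := (Finset.mem_filter.1 hℓ).2
  have hp := hlampos ℓ hℓ0
  have hle : lam ⟨1, hn⟩ ≤ lam ℓ := hmono (Fin.mk_le_of_le_val (by omega))
  have hg : ∑ t ∈ Finset.range N, (1 - c₂ * lam ℓ) ^ t
      = (1 - (1 - c₂ * lam ℓ) ^ N) / (c₂ * lam ℓ) := by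
    rw [geom_sum_eq (by nlinarith [mul_pos hc2 hp])]
    rw [div_eq_div_iff (by nlinarith [mul_pos hc2 hp]) (by positivity)]
    ring
  rw [hg]
  have h3 : -((1 - c₂ * lam ℓ) ^ N * (φ ℓ v * φ ℓ u))
      ≤ Λ ^ N * ((φ ℓ v ^ 2 + φ ℓ u ^ 2) / 2) := by
    refine (neg_le_abs _).trans ?_
    rw [abs_mul, abs_pow]
    exact mul_le_mul (pow_le_pow_left₀ (abs_nonneg _) (hΛ ℓ hℓ0) N) (two_le_sq _ _)
      (abs_nonneg _) (by positivity)
  have h4 : Λ ^ N * ((φ ℓ v ^ 2 + φ ℓ u ^ 2) / 2) / (c₂ * lam ℓ)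
      ≤ Λ ^ N * ((φ ℓ v ^ 2 + φ ℓ u ^ 2) / 2) / (c₂ * lam ⟨1, hn⟩) := by
    gcongr
  refine le_trans ?_ (add_le_add le_rfl h4)
  have h5 := div_le_div_of_nonneg_right h3 (by positivity : 0 ≤ c₂ * lam ℓ)
  calc _ = 1 / lam ℓ * (φ ℓ v * φ ℓ u) / c₂
        + -((1 - c₂ * lam ℓ) ^ N * (φ ℓ v * φ ℓ u)) / (c₂ * lam ℓ) := by
        field_simp
        ring
    _ ≤ _ := by linarith

lemma pow_le_one_entry {𝒜 : Matrix (Fin n) (Fin n) ℝ} (h0 : 0 < n) (hn : 1 < n)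
    (horth : ∀ k l, ∑ a, φ k a * φ l a = if k = l then (1 : ℝ) else 0)
    (heig : ∀ ℓ i, ∑ j, 𝒜 i j * φ ℓ j = (1 - lam ℓ) * φ ℓ i)
    {c₂ : ℝ} (hq : ∀ ℓ, |1 - c₂ * lam ℓ| ≤ 1) (v u : Fin n) (t : ℕ) :
    (Zg c₂ 𝒜 ^ t) v u ≤ 1 := by
  rw [Zg_spectral horth heig c₂]
  have h1 : ∑ ℓ, (φ ℓ v ^ 2 + φ ℓ u ^ 2) / 2 = 1 := by
    rw [← Finset.sum_div, Finset.sum_add_distrib]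
    have hv := complete_of_orth horth v v
    have hu := complete_of_orth horth u u
    simp only [if_true, ← pow_two] at hv hu
    rw [hv, hu]; norm_num
  refine le_trans (Finset.sum_le_sum fun ℓ _ => ?_) h1.le
  refine (le_abs_self _).trans ?_
  rw [abs_mul, abs_pow]
  calc _ ≤ 1 * |φ ℓ v * φ ℓ u| :=
        mul_le_mul_of_nonneg_right (pow_le_one₀ (abs_nonneg _) (hq ℓ)) (abs_nonneg _)
    _ ≤ _ := by rw [one_mul]; exact two_le_sq _ _

lemma gap_le_one {𝒜 : Matrix (Fin n) (Fin n) ℝ} (h0 : 0 < n) (hn : 1 < n)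
    (horth : ∀ k l, ∑ a, φ k a * φ l a = if k = l then (1 : ℝ) else 0)
    (heig : ∀ ℓ i, ∑ j, 𝒜 i j * φ ℓ j = (1 - lam ℓ) * φ ℓ i)
    (hmono : Monotone lam) (v u : Fin n) (hvu : v ≠ u)
    (hvv : 𝒜 v v = 0) (huu : 𝒜 u u = 0) (hvu0 : 𝒜 v u = 0)
    (hpos : 0 < φ ⟨0, h0⟩ v) : lam ⟨1, hn⟩ ≤ 1 := by
  have hS : ∀ a b, 𝒜 a b = ∑ ℓ, (1 - lam ℓ) * (φ ℓ a * φ ℓ b) := by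
    intro a b
    have h := Zg_spectral horth heig 1 1 a b
    simpa [Zg] using h
  set x := φ ⟨0, h0⟩ u
  set y := φ ⟨0, h0⟩ v
  have h1 : ∑ ℓ, (lam ℓ - 1) * (x * φ ℓ v - y * φ ℓ u) ^ 2 = 0 := by
    have : ∑ ℓ, (lam ℓ - 1) * (x * φ ℓ v - y * φ ℓ u) ^ 2
        = -(x^2 * 𝒜 v v + y^2 * 𝒜 u u - 2 * x * y * 𝒜 v u) := by
      rw [hS v v, hS u u, hS v u, Finset.mul_sum, Finset.mul_sum, Finset.mul_sum,
        ← Finset.sum_add_distrib, ← Finset.sum_sub_distrib, ← Finset.sum_neg_distrib]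
      exact Finset.sum_congr rfl fun ℓ _ => by ring
    rw [this, hvv, huu, hvu0]; ring
  have h2 : ∑ ℓ, (x * φ ℓ v - y * φ ℓ u) ^ 2 = x^2 + y^2 := by
    have : ∑ ℓ, (x * φ ℓ v - y * φ ℓ u) ^ 2
        = x^2 * ∑ ℓ, φ ℓ v * φ ℓ v + y^2 * ∑ ℓ, φ ℓ u * φ ℓ u
          - 2 * x * y * ∑ ℓ, φ ℓ v * φ ℓ u := by
      rw [Finset.mul_sum, Finset.mul_sum, Finset.mul_sum,
        ← Finset.sum_add_distrib, ← Finset.sum_sub_distrib]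
      exact Finset.sum_congr rfl fun ℓ _ => by ring
    rw [this, complete_of_orth horth, complete_of_orth horth, complete_of_orth horth]
    simp [hvu]
  have h3 : (lam ⟨1, hn⟩ - 1) * ∑ ℓ, (x * φ ℓ v - y * φ ℓ u) ^ 2
      ≤ ∑ ℓ, (lam ℓ - 1) * (x * φ ℓ v - y * φ ℓ u) ^ 2 := by
    rw [Finset.mul_sum]
    refine Finset.sum_le_sum fun ℓ _ => ?_
    by_cases hℓ : (ℓ : ℕ) = 0
    · have : ℓ = ⟨0, h0⟩ := Fin.ext hℓ
      rw [this]
      have : x * φ ⟨0, h0⟩ v - y * φ ⟨0, h0⟩ u = 0 := by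
        change x * y - y * x = 0
        ring
      rw [this]; simp
    · have hle : lam ⟨1, hn⟩ ≤ lam ℓ := hmono (Fin.mk_le_of_le_val (by omega))
      exact mul_le_mul_of_nonneg_right (by linarith) (sq_nonneg _)
  rw [h1, h2] at h3
  have : 0 < x^2 + y^2 := by positivity
  by_contra hcon
  push Not at hcon
  nlinarith

/-- upper bound for the commute-time term -/
lemma commute_bound (h0 : 0 < n) (hn : 1 < n)
    (horth : ∀ k l, ∑ a, φ k a * φ l a = if k = l then (1 : ℝ) else 0)
    (hmono : Monotone lam) (hlampos : ∀ ℓ : Fin n, (ℓ : ℕ) ≠ 0 → 0 < lam ℓ)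
    (v u : Fin n) {a b γ : ℝ} (ha : 0 < a) (hb : 0 < b) (hab : b / a ≤ γ) (hba : a / b ≤ γ) :
    a * b * ∑ ℓ ∈ Finset.univ.filter (fun ℓ : Fin n => (ℓ : ℕ) ≠ 0),
        (1 / lam ℓ) * (φ ℓ v / a - φ ℓ u / b) ^ 2
      ≤ 2 * (γ * (1 - φ ⟨0, h0⟩ v * φ ⟨0, h0⟩ u) / lam ⟨1, hn⟩)
        - 2 * ∑ ℓ ∈ Finset.univ.filter (fun ℓ : Fin n => (ℓ : ℕ) ≠ 0),
          (1 / lam ℓ) * (φ ℓ v * φ ℓ u) := by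
  have hl1 : 0 < lam ⟨1, hn⟩ := hlampos _ (by simp)
  have hγ : 0 < γ := lt_of_lt_of_le (by positivity) hab
  have h2 : γ * (∑ ℓ ∈ Finset.univ.filter (fun ℓ : Fin n => (ℓ : ℕ) ≠ 0),
      (φ ℓ v ^ 2 + φ ℓ u ^ 2) / 2) / lam ⟨1, hn⟩
      ≤ γ * (1 - φ ⟨0, h0⟩ v * φ ⟨0, h0⟩ u) / lam ⟨1, hn⟩ := by
    have := sum_sq_nontriv h0 horth v u
    gcongr
  have h3 : a * b * ∑ ℓ ∈ Finset.univ.filter (fun ℓ : Fin n => (ℓ : ℕ) ≠ 0),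
        (1 / lam ℓ) * (φ ℓ v / a - φ ℓ u / b) ^ 2
      ≤ 2 * (γ * (∑ ℓ ∈ Finset.univ.filter (fun ℓ : Fin n => (ℓ : ℕ) ≠ 0),
      (φ ℓ v ^ 2 + φ ℓ u ^ 2) / 2) / lam ⟨1, hn⟩)
      - 2 * ∑ ℓ ∈ Finset.univ.filter (fun ℓ : Fin n => (ℓ : ℕ) ≠ 0),
          (1 / lam ℓ) * (φ ℓ v * φ ℓ u) := by
    rw [Finset.mul_sum, Finset.mul_sum, Finset.sum_div, Finset.mul_sum, Finset.mul_sum,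
      ← Finset.sum_sub_distrib]
    refine Finset.sum_le_sum fun ℓ hℓ => ?_
    have hℓ0 : (ℓ : ℕ) ≠ 0 := (Finset.mem_filter.1 hℓ).2
    have hp := hlampos ℓ hℓ0
    have hle : lam ⟨1, hn⟩ ≤ lam ℓ := hmono (Fin.mk_le_of_le_val (by omega))
    have e : a * b * (1 / lam ℓ * (φ ℓ v / a - φ ℓ u / b) ^ 2)
        = (b / a * φ ℓ v ^ 2 + a / b * φ ℓ u ^ 2) / lam ℓ
          - 2 * (1 / lam ℓ * (φ ℓ v * φ ℓ u)) := by
      field_simp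
      ring
    rw [e]
    have h4 : (b / a * φ ℓ v ^ 2 + a / b * φ ℓ u ^ 2) / lam ℓ
        ≤ (γ * φ ℓ v ^ 2 + γ * φ ℓ u ^ 2) / lam ⟨1, hn⟩ := by
      gcongr
    have e2 : 2 * (γ * ((φ ℓ v ^ 2 + φ ℓ u ^ 2) / 2) / lam ⟨1, hn⟩)
        = (γ * φ ℓ v ^ 2 + γ * φ ℓ u ^ 2) / lam ⟨1, hn⟩ := by
      field_simp
    rw [e2]
    linarith
  linarith

end Final

section Assembly

lemma key_alg {x p a L γ : ℝ} (h1 : a ≤ L) (hp0 : 0 ≤ p) (hp2 : 0 ≤ 1 - p) (h2 : x ≤ γ + L) :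
    x * p + a * (1 - p) ≤ γ * p + L := by
  nlinarith [mul_le_mul_of_nonneg_right h1 hp2, mul_le_mul_of_nonneg_right h2 hp0]

/-- the final algebraic rearrangement. -/
lemma final_alg {m p K c₂ l γ L E D M μ c2 Sg T0 T1 : ℝ} (hc2 : 0 < c₂) (hl : 0 < l)
    (hγ : 1 ≤ γ) (hE : 0 < E) (hD : 0 < D) (hμ : μ = 1 + 2 * c2 * (1 + γ)) (hc : 0 ≤ c2)
    (hp : p = D / (2 * E))
    (hS : D * Sg ≤ 2 * (γ * (1 - p) / l) - 2 * K)
    (hT0 : T0 ≤ 2 * m * p + K / c₂ + (γ * p + L) / (c₂ * l))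
    (hT1 : T1 ≤ 2 * m * p + K / c₂ + (γ * p + L) / (c₂ * l))
    (hM : M ≤ γ * (T1 + 2 * c2 * (1 + γ) * T0 + 2 * c2 / c₂)) :
    m ≥ 2 * E * Sg / (4 * c₂) + E / D * (M / (γ * μ) - (1 / c₂) * ((γ + L) / l + 2 * c2 / μ)) := by
  have hμ0 : 0 < μ := by rw [hμ]; positivity
  have hγ0 : 0 < γ := by linarith
  set B := D / E * (m - 2 * E * Sg / (4 * c₂)) + (γ + L) / (c₂ * l) with hB
  have hBB : 2 * m * p + K / c₂ + (γ * p + L) / (c₂ * l) ≤ B := by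
    have h1 : D * Sg / (2 * c₂) ≤ (2 * (γ * (1 - p) / l) - 2 * K) / (2 * c₂) := by gcongr
    have e1 : (2 * (γ * (1 - p) / l) - 2 * K) / (2 * c₂)
        = γ * (1 - p) / (c₂ * l) - K / c₂ := by field_simp
    have e2 : B = 2 * m * p - D * Sg / (2 * c₂) + (γ + L) / (c₂ * l) := by
      rw [hB, hp]; field_simp; ring
    have e3 : (γ + L) / (c₂ * l) = (γ * p + L) / (c₂ * l) + γ * (1 - p) / (c₂ * l) := by
      rw [← add_div]; congr 1; ring
    rw [e2, e3]
    linarith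
  have h2 : M ≤ γ * (μ * B + 2 * c2 / c₂) := by
    refine hM.trans (mul_le_mul_of_nonneg_left ?_ hγ0.le)
    have h3 : 2 * c2 * (1 + γ) * T0 ≤ 2 * c2 * (1 + γ) * B :=
      mul_le_mul_of_nonneg_left (hT0.trans hBB) (by positivity)
    have h4 := hT1.trans hBB
    rw [hμ]
    linarith
  have h5 : M / (γ * μ) ≤ B + 2 * c2 / (c₂ * μ) := by
    rw [div_le_iff₀ (by positivity)]
    refine h2.trans (le_of_eq ?_)
    field_simp
  have h6 : E / D * (M / (γ * μ) - (1 / c₂) * ((γ + L) / l + 2 * c2 / μ))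
      ≤ E / D * (D / E * (m - 2 * E * Sg / (4 * c₂))) := by
    refine mul_le_mul_of_nonneg_left ?_ (by positivity)
    have e : (1 / c₂) * ((γ + L) / l + 2 * c2 / μ) = (γ + L) / (c₂ * l) + 2 * c2 / (c₂ * μ) := by
      field_simp
    rw [e]
    linarith
  have e : E / D * (D / E * (m - 2 * E * Sg / (4 * c₂))) = m - 2 * E * Sg / (4 * c₂) := by
    field_simp
  linarith

/-- the layer-summed mixing bound. -/
lemma mixing_bound {𝒜 : Matrix (Fin n) (Fin n) ℝ} (hA : ∀ i j, 0 ≤ 𝒜 i j)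
    (hsym : ∀ i j, 𝒜 i j = 𝒜 j i) {γ : ℝ} (hγ1 : 1 ≤ γ)
    (hrow : ∀ i, ∑ j, 𝒜 i j ≤ γ) {ω w c₁ c₂ c2 : ℝ} (hw : 0 < w) (hw1 : w ≤ 1)
    (hc1 : 0 ≤ c₁) (hc2 : 0 < c₂) (hc21 : c₂ ≤ 1) (hc : 0 ≤ c2)
    (hcap : ω / w + c₁ * γ + c₂ ≤ 1)
    (σ : ℝ → ℝ) (hσ : ContDiff ℝ 2 σ)
    (hσ' : ∀ x, |deriv σ x| ≤ 1) (hσ'' : ∀ x, |deriv (deriv σ) x| ≤ 1)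
    (Ω W : ℕ → EuclideanSpace ℝ (Fin d) →L[ℝ] EuclideanSpace ℝ (Fin d))
    (hΩ : ∀ t, ‖Ω t‖ ≤ ω) (hW : ∀ t, ‖W t‖ ≤ w)
    (ψ : ℕ → EuclideanSpace ℝ (Fin d) × EuclideanSpace ℝ (Fin d) → EuclideanSpace ℝ (Fin d))
    (hψ : ∀ t, ContDiff ℝ 2 (ψ t))
    (hψ₁ : ∀ t x y, ‖fderiv ℝ (fun z => ψ t (z, y)) x‖ ≤ c₁)
    (hψ₂ : ∀ t x y, ‖fderiv ℝ (fun z => ψ t (x, z)) y‖ ≤ c₂)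
    (hψ₃ : ∀ t p, ‖iteratedFDeriv ℝ 2 (ψ t) p‖ ≤ c2)
    (s : Fin n → ℝ) {S0 S : ℝ} (hS0 : 0 < S0) (hsS0 : ∀ i, S0 ≤ s i) (hsS : ∀ i, s i ≤ S)
    (hSγ : S / S0 = γ)
    (hsA : ∀ j, ∑ i, s i * 𝒜 i j = s j)
    (θ : EuclideanSpace ℝ (Fin d)) (hθ : ‖θ‖ = 1)
    (v u : Fin n) (hvu : v ≠ u) (α β : Fin d) (X : Fin n → EuclideanSpace ℝ (Fin d)) (m : ℕ) :
    |mixEntry θ σ 𝒜 Ω W ψ m v u X α β| ≤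
      γ * (∑ t ∈ Finset.range (2*m+1), (Zg c₂ 𝒜 ^ t) v u
        + 2 * c2 * (1 + γ) * ∑ t ∈ Finset.range (2*m), (Zg c₂ 𝒜 ^ t) v u
        + 2 * c2 * (Zg c₂ 𝒜 ^ (2*m)) v u / c₂) := by
  have hs : ∀ i, 0 ≤ s i := fun i => hS0.le.trans (hsS0 i)
  have hSn : 0 ≤ S := (hs v).trans (hsS v)
  obtain ⟨hC, -, hB⟩ := network_bound hA hrow hw hw1 hc1 hc2.le hc21 hc hcap σ hσ hσ' hσ'' Ω W
    hΩ hW ψ hψ hψ₁ hψ₂ hψ₃ s hs hsA v u α β X m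
  have h1 := mix_le θ hθ σ Ω W ψ m v u X α β hC
  have hZ := fun t => Zg_pow_nonneg (𝒜 := 𝒜) hc2.le hc21 hA t v u
  have h2 := seq_bound (fun t => (Zg c₂ 𝒜 ^ t) v u) hZ (by simp [hvu])
    hc2 hc hγ1 (fun t => by
      change _ ≤ (Zg c₂ 𝒜 ^ (t+1)) v u
      rw [pow_succ', Zg_mul_apply]
      have : 0 ≤ c₂ * ∑ j, 𝒜 v j * (Zg c₂ 𝒜 ^ t) j u :=
        mul_nonneg hc2.le (Finset.sum_nonneg fun j _ => mul_nonneg (hA v j)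
          (Zg_pow_nonneg hc2.le hc21 hA t j u))
      linarith) m
  have h3 := hB.trans (Finset.sum_le_sum fun t _ =>
    total_bound hA hsym hrow s hs hsA hsS hc2 hc21 hc v u t)
  rw [← Finset.mul_sum] at h3
  have h4 := h3.trans (mul_le_mul_of_nonneg_left h2 hSn)
  have h5 : S0 * ∑ i, ‖D2 (fun Y => mpnn σ 𝒜 Ω W ψ m Y i) X (dir v α) (dir u β)‖
      ≤ ∑ i, s i * ‖D2 (fun Y => mpnn σ 𝒜 Ω W ψ m Y i) X (dir v α) (dir u β)‖ := by
    rw [Finset.mul_sum]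
    exact Finset.sum_le_sum fun i _ => mul_le_mul_of_nonneg_right (hsS0 i) (norm_nonneg _)
  have h6 := (mul_le_mul_of_nonneg_left h1 hS0.le).trans (h5.trans h4)
  rw [← hSγ, div_mul_eq_mul_div, le_div_iff₀ hS0, mul_comm _ S0]
  rw [hSγ]
  exact h6

end Assembly

set_option maxHeartbeats 1000000 in
/-- Theorem 4.3: lower bound on the depth needed to generate mixing
`M` among `v,u`, in terms of the commute time, for `𝒜 = A_sym`. -/
theorem depth_lower_bound_sym (hn : 1 < n)
    (G : SimpleGraph (Fin n)) [DecidableRel G.Adj] (hconn : G.Connected)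
    (σ : ℝ → ℝ) (hσ : ContDiff ℝ 2 σ)
    (hσ' : ∀ x, |deriv σ x| ≤ 1) (hσ'' : ∀ x, |deriv (deriv σ) x| ≤ 1)
    (Ω W : ℕ → EuclideanSpace ℝ (Fin d) →L[ℝ] EuclideanSpace ℝ (Fin d))
    (ω w : ℝ) (hw : 0 < w) (hΩ : ∀ t, ‖Ω t‖ ≤ ω) (hW : ∀ t, ‖W t‖ ≤ w)
    (ψ : ℕ → EuclideanSpace ℝ (Fin d) × EuclideanSpace ℝ (Fin d) → EuclideanSpace ℝ (Fin d))
    (hψ : ∀ t, ContDiff ℝ 2 (ψ t)) (c₁ c₂ c2 : ℝ) (hc₂0 : 0 < c₂) (hc₂1 : c₂ ≤ 1)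
    (hψ₁ : ∀ t x y, ‖fderiv ℝ (fun z => ψ t (z, y)) x‖ ≤ c₁)
    (hψ₂ : ∀ t x y, ‖fderiv ℝ (fun z => ψ t (x, z)) y‖ ≤ c₂)
    (hψ₃ : ∀ t p, ‖iteratedFDeriv ℝ 2 (ψ t) p‖ ≤ c2)
    (γ : ℝ) (hγ : γ = Real.sqrt ((G.maxDegree : ℝ) / (G.minDegree : ℝ)))
    (hw1 : w ≤ 1) (hcap : ω / w + c₁ * γ + c₂ ≤ 1)
    (lam : Fin n → ℝ) (φ : Fin n → Fin n → ℝ)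
    (horth : ∀ k l, ∑ a, φ k a * φ l a = if k = l then (1 : ℝ) else 0)
    (heig : ∀ ℓ, (nLap G).mulVec (φ ℓ) = lam ℓ • φ ℓ)
    (hmono : Monotone lam)
    (hlam0 : lam ⟨0, by omega⟩ = 0)
    (hlampos : ∀ ℓ : Fin n, (ℓ : ℕ) ≠ 0 → 0 < lam ℓ)
    (hlamlt : ∀ ℓ, lam ℓ < 2)
    (hφ0 : ∀ a, φ ⟨0, by omega⟩ a = Real.sqrt ((G.degree a : ℝ) / (2 * G.edgeFinset.card)))
    (Λ : ℝ)
    (hΛ : IsGreatest {x : ℝ | ∃ ℓ : Fin n, (ℓ : ℕ) ≠ 0 ∧ x = |1 - c₂ * lam ℓ|} Λ)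
    (μ : ℝ) (hμ : μ = 1 + 2 * c2 * (1 + γ))
    (v u : Fin n) (hvu : v ≠ u) (r : ℕ) (hr : r = G.dist v u)
    (θ : EuclideanSpace ℝ (Fin d)) (hθ : ‖θ‖ = 1)
    (m : ℕ) (M : ℝ) (hM : 0 < M)
    (X : Fin n → EuclideanSpace ℝ (Fin d)) (α β : Fin d)
    (hmix : M ≤ |OSQ.mixEntry θ σ (Asym G) Ω W ψ m v u X α β|) :
    (m : ℝ) ≥ commuteTime G lam φ v u / (4 * c₂)
        + (G.edgeFinset.card : ℝ) / Real.sqrt ((G.degree v : ℝ) * (G.degree u : ℝ)) *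
            (M / (γ * μ)
              - (1 / c₂) * ((γ + Λ ^ (r - 1)) / lam ⟨1, hn⟩ + 2 * c2 / μ)) := by
  have h0 : 0 < n := by omega
  have : Nontrivial (Fin n) := Fin.nontrivial_iff_two_le.2 hn
  have : Nonempty (Fin n) := ⟨v⟩
  have hpos : ∀ i, 0 < G.degree i := fun i => hconn.preconnected.degree_pos_of_nontrivial i
  have hposR : ∀ i, (0 : ℝ) < G.degree i := fun i => Nat.cast_pos.2 (hpos i)
  have hmin : 0 < G.minDegree := by
    obtain ⟨i, hi⟩ := G.exists_minimal_degree_vertex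
    rw [hi]; exact hpos i
  have hminR : (0 : ℝ) < G.minDegree := Nat.cast_pos.2 hmin
  have hS0 : 0 < Real.sqrt G.minDegree := Real.sqrt_pos.2 hminR
  have hsS0 : ∀ i, Real.sqrt G.minDegree ≤ Real.sqrt (G.degree i) := fun i =>
    Real.sqrt_le_sqrt (Nat.cast_le.2 (G.minDegree_le_degree i))
  have hsS : ∀ i, Real.sqrt (G.degree i) ≤ Real.sqrt G.maxDegree := fun i =>
    Real.sqrt_le_sqrt (Nat.cast_le.2 (G.degree_le_maxDegree i))
  have hSγ : Real.sqrt G.maxDegree / Real.sqrt G.minDegree = γ := by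
    rw [hγ, Real.sqrt_div (Nat.cast_nonneg _)]
  have hratio : ∀ i j, Real.sqrt (G.degree i) / Real.sqrt (G.degree j) ≤ γ := by
    intro i j
    rw [← hSγ]
    exact div_le_div₀ (Real.sqrt_nonneg _) (hsS i) hS0 (hsS0 j)
  have hspos : ∀ i, 0 < Real.sqrt (G.degree i) := fun i => Real.sqrt_pos.2 (hposR i)
  have hγ1 : 1 ≤ γ := by
    have := hratio v v
    rwa [div_self (hspos v).ne'] at this
  have hc1 : 0 ≤ c₁ := (norm_nonneg _).trans (hψ₁ 0 0 0)
  have hc : 0 ≤ c2 := (norm_nonneg _).trans (hψ₃ 0 0)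
  have hl1 : 0 < lam ⟨1, hn⟩ := hlampos _ (by simp)
  have heig' : ∀ ℓ i, ∑ j, Asym G i j * φ ℓ j = (1 - lam ℓ) * φ ℓ i := by
    intro ℓ i
    have h := congrFun (heig ℓ) i
    rw [nLap, Matrix.sub_mulVec, Matrix.one_mulVec] at h
    simp only [Pi.sub_apply, Pi.smul_apply, smul_eq_mul] at h
    have e : (Asym G).mulVec (φ ℓ) i = ∑ j, Asym G i j * φ ℓ j := rfl
    rw [e] at h
    linarith
  have hmixb := hmix.trans (mixing_bound (Asym_nonneg G) (Asym_symm G) hγ1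
    (Asym_row G hpos hratio) hw hw1 hc1 hc₂0 hc₂1 hc hcap σ hσ hσ' hσ'' Ω W hΩ hW ψ hψ hψ₁ hψ₂ hψ₃
    (fun i => Real.sqrt (G.degree i)) hS0 hsS0 hsS hSγ (Asym_stat G hpos) θ hθ v u hvu α β X m)
  have hrm : r ≤ 2 * m := by
    by_contra hlt
    push Not at hlt
    have hz : ∀ t, t ≤ 2 * m → (Zg c₂ (Asym G) ^ t) v u = 0 := fun t ht =>
      Zg_zero G hconn c₂ t v u (by omega)
    rw [Finset.sum_eq_zero (fun t ht => hz t (by have := Finset.mem_range.1 ht; omega)),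
      Finset.sum_eq_zero (fun t ht => hz t (by have := Finset.mem_range.1 ht; omega)),
      hz _ le_rfl] at hmixb
    simp at hmixb
    linarith
  have hr1 : 1 ≤ r := by
    rw [hr]; exact hconn.pos_dist_of_ne hvu
  have hlamnn : ∀ ℓ, 0 ≤ lam ℓ := by
    intro ℓ
    by_cases h : (ℓ : ℕ) = 0
    · have : ℓ = ⟨0, h0⟩ := Fin.ext h
      rw [this, hlam0]
    · exact (hlampos ℓ h).le
  have hq : ∀ ℓ, |1 - c₂ * lam ℓ| ≤ 1 := by
    intro ℓ
    rw [abs_le]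
    constructor <;> nlinarith [hlamnn ℓ, hlamlt ℓ]
  have hΛu : ∀ ℓ : Fin n, (ℓ : ℕ) ≠ 0 → |1 - c₂ * lam ℓ| ≤ Λ := fun ℓ hℓ => hΛ.2 ⟨ℓ, hℓ, rfl⟩
  have hΛ0 : 0 ≤ Λ := (abs_nonneg _).trans (hΛu ⟨1, hn⟩ (by simp))
  have hΛ1 : Λ ≤ 1 := by
    obtain ⟨ℓ, -, h⟩ := hΛ.1
    rw [h]; exact hq ℓ
  have hE : (0 : ℝ) < G.edgeFinset.card := by
    rw [Nat.cast_pos, Finset.card_pos]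
    obtain ⟨j, hj⟩ := (G.degree_pos_iff_exists_adj v).1 (hpos v)
    exact ⟨s(v, j), by rw [SimpleGraph.mem_edgeFinset]; exact hj⟩
  have hDe : Real.sqrt ((G.degree v : ℝ) * G.degree u)
      = Real.sqrt (G.degree v) * Real.sqrt (G.degree u) := Real.sqrt_mul (Nat.cast_nonneg _) _
  have hD : 0 < Real.sqrt ((G.degree v : ℝ) * G.degree u) := by
    rw [hDe]; exact mul_pos (hspos v) (hspos u)
  have hp : φ ⟨0, h0⟩ v * φ ⟨0, h0⟩ u
      = Real.sqrt ((G.degree v : ℝ) * G.degree u) / (2 * G.edgeFinset.card) := by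
    rw [hφ0, hφ0, Real.sqrt_div (Nat.cast_nonneg _), Real.sqrt_div (Nat.cast_nonneg _),
      div_mul_div_comm, hDe, Real.mul_self_sqrt (by positivity)]
  have hSg := commute_bound h0 hn horth hmono hlampos v u (hspos v) (hspos u) (hratio u v) (hratio v u)
  have hpb := fun N => partial_sum_bound h0 hn horth heig' hmono hlam0 hlampos hc₂0 hΛu v u N
  have hT0 := hpb (2 * m)
  have hT1 := hpb (2 * m + 1)
  have hp1 := sum_sq_nontriv h0 horth v u
  have hp2 : 0 ≤ 1 - φ ⟨0, h0⟩ v * φ ⟨0, h0⟩ u :=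
    le_trans (Finset.sum_nonneg fun ℓ _ => by positivity) hp1
  have hp0 : 0 ≤ φ ⟨0, h0⟩ v * φ ⟨0, h0⟩ u := by rw [hp]; positivity
  have hφv : 0 < φ ⟨0, h0⟩ v := by
    rw [hφ0]
    exact Real.sqrt_pos.2 (div_pos (hposR v) (by positivity))
  have hgap : 2 ≤ r → lam ⟨1, hn⟩ ≤ 1 := by
    intro hr2
    refine gap_le_one h0 hn horth heig' hmono v u hvu ?_ ?_ ?_ hφv
    · rw [Asym_apply, if_neg (G.loopless.irrefl v)]
    · rw [Asym_apply, if_neg (G.loopless.irrefl u)]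
    · rw [Asym_apply, if_neg]
      intro hadj
      rw [SimpleGraph.dist_eq_one_iff_adj.2 hadj] at hr
      omega
  have hz1 := pow_le_one_entry h0 hn horth heig' hq v u (2 * m)
  rw [← hDe] at hSg
  set p := φ ⟨0, h0⟩ v * φ ⟨0, h0⟩ u with hpdef
  have hL0 : 0 ≤ Λ ^ (r - 1) := by positivity
  have hLa : Λ ^ (2 * m) ≤ Λ ^ (r - 1) := pow_le_pow_of_le_one hΛ0 hΛ1 (by omega)
  have hLb : Λ ^ (2 * m + 1) ≤ Λ ^ (r - 1) := pow_le_pow_of_le_one hΛ0 hΛ1 (by omega)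
  have hc₂l : 0 < c₂ * lam ⟨1, hn⟩ := mul_pos hc₂0 hl1
  have hkey : c₂ * lam ⟨1, hn⟩ * p + Λ ^ (2 * m + 1) * (1 - p) ≤ γ * p + Λ ^ (r - 1) := by
    refine key_alg hLb hp0 hp2 ?_
    rcases Nat.lt_or_ge r 2 with hlt | hge
    · have : r - 1 = 0 := by omega
      rw [this, pow_zero]
      exact (mul_le_of_le_one_left hl1.le hc₂1).trans (by linarith [hlamlt ⟨1, hn⟩])
    · exact (mul_le_of_le_one_left hl1.le hc₂1).trans (by linarith [hgap hge])
  refine final_alg hc₂0 hl1 hγ1 hE hD hμ hc hp hSg (hT0.trans ?_) (hT1.trans ?_)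
    (hmixb.trans ?_)
  · have : Λ ^ (2 * m) * (1 - p) / (c₂ * lam ⟨1, hn⟩)
        ≤ (γ * p + Λ ^ (r - 1)) / (c₂ * lam ⟨1, hn⟩) := by
      refine div_le_div_of_nonneg_right ?_ hc₂l.le
      have h1 := key_alg (x := 0) (γ := γ) hLa hp0 hp2 (by linarith)
      rwa [zero_mul, zero_add] at h1
    push_cast
    exact add_le_add le_rfl this
  · have : p + Λ ^ (2 * m + 1) * (1 - p) / (c₂ * lam ⟨1, hn⟩)
        ≤ (γ * p + Λ ^ (r - 1)) / (c₂ * lam ⟨1, hn⟩) := by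
      rw [le_div_iff₀ hc₂l, add_mul, div_mul_cancel₀ _ hc₂l.ne']
      linarith
    push_cast
    linarith
  · have : 2 * c2 * (Zg c₂ (Asym G) ^ (2 * m)) v u / c₂ ≤ 2 * c2 / c₂ := by
      refine div_le_div_of_nonneg_right ?_ hc₂0.le
      exact mul_le_of_le_one_right (by positivity) hz1
    refine mul_le_mul_of_nonneg_left ?_ (by linarith)
    linarith
end OSQ
end
end
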